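/- arXiv:2012.01161 — 3 statements merged into one kernel-verified Lean document; each statement's English description precedes it below -/
import Mathlib

section
/- ∫_0^{π/2} ln(x² + ln²(2 cos x)) dx = 0. -/
open Real

open Filter Topology MeasureTheory Metric

/-- The function `log ‖log (1 + z) / z‖`, harmonic on the punctured unit disc. -/
noncomputable def logNormLogDiv (z : ℂ) : ℝ := Real.log ‖Complex.log (1 + z) / z‖

lemma one_add_mem_slitPlane_of_norm_le_one {z : ℂ} (hz : ‖z‖ ≤ 1) (h : 1 + z ≠ 0) :
    1 + z ∈ Complex.slitPlane := by
  rw [Complex.mem_slitPlane_iff]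
  by_contra! hc
  obtain ⟨h1, h2⟩ := hc
  have h3 : -1 ≤ z.re := by
    have := Complex.abs_re_le_norm z
    have := neg_abs_le z.re
    linarith
  apply h
  simp only [Complex.add_re, Complex.one_re] at h1
  apply Complex.ext
  · simp only [Complex.add_re, Complex.one_re, Complex.zero_re]; linarith
  · exact h2

lemma log_one_add_ne_zero {z : ℂ} (h : 1 + z ≠ 0) (hz : z ≠ 0) : Complex.log (1 + z) ≠ 0 := by
  intro h0
  have := Complex.exp_log h
  rw [h0, Complex.exp_zero] at this
  exact hz (by linear_combination -this)

lemma circleAverage_logNormLogDiv {r : ℝ} (h0 : 0 < r) (h1 : r < 1) :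
    circleAverage logNormLogDiv 0 r = 0 := by
  set f : ℂ → ℂ := fun z ↦ Complex.log (1 + z) with hf
  have hmem : ∀ z ∈ ball (0 : ℂ) 1, 1 + z ∈ Complex.slitPlane := fun z hz ↦
    Complex.mem_slitPlane_of_norm_lt_one (by simpa using hz)
  have hd : DifferentiableOn ℂ f (ball 0 1) := fun z hz ↦
    ((differentiableAt_id.const_add 1).clog (hmem z hz)).differentiableWithinAt
  have hd' : DifferentiableOn ℂ (dslope f 0) (ball 0 1) :=
    (Complex.differentiableOn_dslope (isOpen_ball.mem_nhds (mem_ball_self one_pos))).mpr hd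
  have hsub : closedBall (0 : ℂ) |r| ⊆ ball 0 1 := by
    rw [abs_of_pos h0]; exact closedBall_subset_ball h1
  have hderiv : deriv f 0 = 1 := by
    have : HasDerivAt f (1 / (1 + 0)) 0 :=
      ((hasDerivAt_id (0 : ℂ)).const_add 1).clog (by simp)
    simpa using this.deriv
  have hdiv : ∀ z, z ≠ 0 → dslope f 0 z = Complex.log (1 + z) / z := by
    intro z hz
    rw [dslope_of_ne _ hz, slope_def_field]
    simp [hf]
  have key : circleAverage (fun z ↦ Real.log ‖dslope f 0 z‖) 0 r = Real.log ‖dslope f 0 0‖ := by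
    apply AnalyticOnNhd.circleAverage_log_norm_of_ne_zero
    · exact (hd'.analyticOnNhd isOpen_ball).mono hsub
    · intro u hu
      rcases eq_or_ne u 0 with rfl | hu0
      · simp [hderiv]
      · rw [hdiv u hu0]
        exact div_ne_zero
          (log_one_add_ne_zero (Complex.slitPlane_ne_zero (hmem u (hsub hu))) hu0) hu0
  rw [dslope_same, hderiv, norm_one, Real.log_one] at key
  rw [← key]
  apply circleAverage_congr_sphere
  intro z hz
  have hz0 : z ≠ 0 := by
    rintro rfl
    rw [mem_sphere, dist_self] at hz
    exact (abs_pos.mpr h0.ne').ne hz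
  simp [logNormLogDiv, hdiv z hz0]

lemma norm_le_two_mul_norm_log_one_add {z : ℂ} (hz : ‖z‖ ≤ 1) (h : 1 + z ≠ 0) :
    ‖z‖ ≤ 2 * ‖Complex.log (1 + z)‖ := by
  rcases le_total ‖Complex.log (1 + z)‖ 1 with hl | hl
  · have := Complex.norm_exp_sub_one_le hl
    rwa [Complex.exp_log h, add_sub_cancel_left] at this
  · linarith

lemma norm_log_le_abs_log_norm_add_pi (w : ℂ) : ‖Complex.log w‖ ≤ |Real.log ‖w‖| + π := by
  refine (Complex.norm_le_abs_re_add_abs_im _).trans ?_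
  rw [Complex.log_re, Complex.log_im]
  gcongr
  exact Complex.abs_arg_le_pi w

lemma abs_log_le_add_one {t : ℝ} (ht : 1 / 2 ≤ t) : |Real.log t| ≤ t + 1 := by
  have h0 : 0 < t := by linarith
  rw [abs_le]
  constructor
  · have := Real.one_sub_inv_le_log_of_pos h0
    have : t⁻¹ ≤ 2 := by
      rw [inv_le_comm₀ h0 two_pos]; linarith
    linarith
  · linarith [Real.log_le_sub_one_of_pos h0]

lemma abs_log_norm_one_add_mul_le {r : ℝ} {e : ℂ} (h0 : 0 ≤ r) (h1 : r ≤ 1) (he : ‖e‖ = 1)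
    (hne : 1 + e ≠ 0) :
    1 + r * e ≠ 0 ∧ |Real.log ‖1 + r * e‖| ≤ |Real.log ‖1 + e‖| + 1 := by
  have hr : ‖(r : ℂ) * e‖ = r := by simp [he, abs_of_nonneg h0]
  have hpos : 0 < ‖1 + e‖ := norm_pos_iff.mpr hne
  have hlow : ‖1 + e‖ / 2 ≤ ‖1 + r * e‖ := by
    have a1 : 1 - r ≤ ‖1 + r * e‖ := by
      have := norm_sub_le (1 + r * e) (r * e)
      rw [add_sub_cancel_right, norm_one, hr] at this
      linarith
    have a2 : ‖1 + e‖ ≤ ‖1 + r * e‖ + (1 - r) := by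
      have e1 : 1 + e = (1 + r * e) + ((1 - r : ℝ) : ℂ) * e := by push_cast; ring
      have e2 : ‖((1 - r : ℝ) : ℂ) * e‖ = 1 - r := by
        rw [norm_mul, he, mul_one, Complex.norm_real, Real.norm_of_nonneg (by linarith)]
      calc ‖1 + e‖ = ‖(1 + r * e) + ((1 - r : ℝ) : ℂ) * e‖ := by rw [← e1]
        _ ≤ _ := (norm_add_le _ _).trans (by rw [e2])
    linarith
  have hup : ‖1 + r * e‖ ≤ 2 := by
    have := norm_add_le 1 (r * e)
    rw [norm_one, hr] at this
    linarith
  have hpos' : 0 < ‖1 + r * e‖ := by linarith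
  have hlog2 : Real.log 2 ≤ 1 := by linarith [Real.log_two_lt_d9]
  refine ⟨norm_pos_iff.mp hpos', abs_le.mpr ⟨?_, ?_⟩⟩
  · have := Real.log_le_log (by positivity) hlow
    rw [Real.log_div hpos.ne' two_ne_zero] at this
    linarith [neg_abs_le (Real.log ‖1 + e‖)]
  · have := Real.log_le_log hpos' hup
    linarith [abs_nonneg (Real.log ‖1 + e‖)]

lemma abs_logNormLogDiv_mul_le {r : ℝ} {e : ℂ} (h0 : 1 / 2 ≤ r) (h1 : r ≤ 1) (he : ‖e‖ = 1)
    (hne : 1 + e ≠ 0) :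
    |logNormLogDiv (r * e)| ≤ 2 * (|Real.log ‖1 + e‖| + 1 + π) + 1 := by
  have hr : ‖(r : ℂ) * e‖ = r := by simp [he, abs_of_nonneg (show 0 ≤ r by linarith)]
  obtain ⟨hz, hb⟩ := abs_log_norm_one_add_mul_le (by linarith) h1 he hne
  have hl := norm_le_two_mul_norm_log_one_add (hr.le.trans h1) hz
  have hu := norm_log_le_abs_log_norm_add_pi (1 + r * e)
  have hrpos : 0 < r := by linarith
  rw [hr] at hl
  have ht : ‖Complex.log (1 + r * e) / (r * e)‖ = ‖Complex.log (1 + r * e)‖ / r := by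
    rw [norm_div, hr]
  unfold logNormLogDiv
  rw [ht]
  refine (abs_log_le_add_one ?_).trans ?_
  · rw [le_div_iff₀ hrpos]; linarith
  · have : ‖Complex.log (1 + r * e)‖ / r ≤ 2 * ‖Complex.log (1 + r * e)‖ := by
      rw [div_le_iff₀ hrpos]
      nlinarith [norm_nonneg (Complex.log (1 + r * e))]
    linarith

lemma measurable_logNormLogDiv : Measurable logNormLogDiv := by
  unfold logNormLogDiv
  fun_prop

lemma continuousAt_logNormLogDiv {z : ℂ} (hz : ‖z‖ ≤ 1) (hz0 : z ≠ 0) (h : 1 + z ≠ 0) :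
    ContinuousAt logNormLogDiv z := by
  have h1 : ContinuousAt (fun z ↦ Complex.log (1 + z)) z :=
    (continuousAt_const.add continuousAt_id).clog (one_add_mem_slitPlane_of_norm_le_one hz h)
  exact (h1.div continuousAt_id hz0).norm.log
    (norm_ne_zero_iff.mpr (div_ne_zero (log_one_add_ne_zero h hz0) hz0))

lemma circleMap_zero_eq_mul (r θ : ℝ) : circleMap 0 r θ = r * circleMap 0 1 θ := by
  simp [circleMap]

lemma ae_one_add_circleMap_ne_zero :
    ∀ᵐ θ : ℝ, θ ∈ Set.uIoc 0 (2 * π) → 1 + circleMap 0 1 θ ≠ 0 := by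
  filter_upwards [Measure.ae_ne volume π] with θ hθ hmem h0
  rw [Set.uIoc_of_le two_pi_pos.le] at hmem
  have hc : Real.cos θ = -1 := by
    have := congrArg Complex.re h0
    simp [circleMap, Complex.exp_ofReal_mul_I_re] at this
    linarith
  have : Real.cos (θ - π) = 1 := by rw [Real.cos_sub_pi, hc, neg_neg]
  have := (Real.cos_eq_one_iff_of_lt_of_lt (by linarith [hmem.1, Real.pi_pos])
    (by linarith [hmem.2, Real.pi_pos])).mp this
  exact hθ (by linarith)

lemma intervalIntegrable_logNormLogDiv_bound :
    IntervalIntegrable (fun θ ↦ 2 * (|Real.log ‖1 + circleMap 0 1 θ‖| + 1 + π) + 1)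
      volume 0 (2 * π) := by
  have h : CircleIntegrable (fun z ↦ Real.log ‖z - (-1)‖) 0 1 :=
    circleIntegrable_log_norm_sub_const 1
  have h' : IntervalIntegrable (fun θ ↦ Real.log ‖1 + circleMap 0 1 θ‖) volume 0 (2 * π) := by
    simpa [CircleIntegrable, add_comm] using h
  exact (((h'.abs.add intervalIntegrable_const).add intervalIntegrable_const).const_mul 2).add
    intervalIntegrable_const

lemma intervalIntegrable_logNormLogDiv_circleMap :
    IntervalIntegrable (fun θ ↦ logNormLogDiv (circleMap 0 1 θ)) volume 0 (2 * π) := by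
  refine intervalIntegrable_logNormLogDiv_bound.mono_fun'
    (measurable_logNormLogDiv.comp (continuous_circleMap 0 1).measurable).aestronglyMeasurable ?_
  rw [EventuallyLE, ae_restrict_iff' measurableSet_uIoc]
  filter_upwards [ae_one_add_circleMap_ne_zero] with θ hθ hmem
  simpa using abs_logNormLogDiv_mul_le (r := 1) (by norm_num) le_rfl (by simp) (hθ hmem)

lemma integral_logNormLogDiv_circleMap :
    ∫ θ in (0 : ℝ)..(2 * π), logNormLogDiv (circleMap 0 1 θ) = 0 := by
  have hev : ∀ᶠ r : ℝ in 𝓝[<] 1, r ∈ Set.Ioo (1 / 2 : ℝ) 1 :=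
    Ioo_mem_nhdsLT (by norm_num)
  have hlim : Tendsto (fun r : ℝ ↦ ∫ θ in (0 : ℝ)..(2 * π), logNormLogDiv (circleMap 0 r θ))
      (𝓝[<] 1) (𝓝 (∫ θ in (0 : ℝ)..(2 * π), logNormLogDiv (circleMap 0 1 θ))) := by
    refine intervalIntegral.tendsto_integral_filter_of_dominated_convergence _ ?_ ?_
      intervalIntegrable_logNormLogDiv_bound ?_
    · exact .of_forall fun r ↦
        (measurable_logNormLogDiv.comp (continuous_circleMap 0 r).measurable).aestronglyMeasurable
    · filter_upwards [hev] with r hr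
      filter_upwards [ae_one_add_circleMap_ne_zero] with θ hθ hmem
      rw [circleMap_zero_eq_mul, Real.norm_eq_abs]
      exact abs_logNormLogDiv_mul_le hr.1.le hr.2.le (by simp) (hθ hmem)
    · filter_upwards [ae_one_add_circleMap_ne_zero] with θ hθ hmem
      have hc : ContinuousAt logNormLogDiv (circleMap 0 1 θ) :=
        continuousAt_logNormLogDiv (by simp) (circleMap_ne_center one_ne_zero) (hθ hmem)
      have hr : Continuous fun r : ℝ ↦ circleMap 0 r θ := by
        unfold circleMap; fun_prop
      exact hc.tendsto.comp ((hr.tendsto 1).mono_left nhdsWithin_le_nhds)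
  refine tendsto_nhds_unique hlim (tendsto_const_nhds.congr' ?_)
  filter_upwards [hev] with r hr
  have := circleAverage_logNormLogDiv (r := r) (by linarith [hr.1]) hr.2
  rw [circleAverage_def, smul_eq_mul] at this
  exact ((mul_eq_zero.mp this).resolve_left (by positivity)).symm

lemma logNormLogDiv_conj {z : ℂ} (hz : ‖z‖ ≤ 1) (h : 1 + z ≠ 0) :
    logNormLogDiv (starRingEnd ℂ z) = logNormLogDiv z := by
  have h1 := Complex.log_conj (1 + z)
    (Complex.slitPlane_arg_ne_pi (one_add_mem_slitPlane_of_norm_le_one hz h))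
  rw [map_add, map_one] at h1
  rw [logNormLogDiv, h1, ← map_div₀, Complex.norm_conj, logNormLogDiv]

lemma circleMap_two_pi_sub (θ : ℝ) :
    circleMap 0 1 (2 * π - θ) = starRingEnd ℂ (circleMap 0 1 θ) := by
  simp [circleMap, ← Complex.exp_conj, sub_mul, Complex.exp_sub, Complex.exp_neg]

lemma integral_logNormLogDiv_half_circle :
    ∫ θ in (0 : ℝ)..π, logNormLogDiv (circleMap 0 1 θ) = 0 := by
  have hsub : ∀ {a b : ℝ}, a ∈ Set.Icc 0 (2 * π) → b ∈ Set.Icc 0 (2 * π) →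
      IntervalIntegrable (fun θ ↦ logNormLogDiv (circleMap 0 1 θ)) volume a b := by
    intro a b ha hb
    refine intervalIntegrable_logNormLogDiv_circleMap.mono_set ?_
    rw [Set.uIcc_of_le two_pi_pos.le]
    exact Set.uIcc_subset_Icc ha hb
  have hpi := Real.pi_pos
  have hadd := intervalIntegral.integral_add_adjacent_intervals
    (hsub (a := 0) (b := π) ⟨le_rfl, by linarith⟩ ⟨hpi.le, by linarith⟩)
    (hsub (a := π) (b := 2 * π) ⟨hpi.le, by linarith⟩ ⟨by linarith, le_rfl⟩)
  have hrefl : ∫ θ in π..(2 * π), logNormLogDiv (circleMap 0 1 θ) =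
      ∫ θ in (0 : ℝ)..π, logNormLogDiv (circleMap 0 1 θ) := by
    have := intervalIntegral.integral_comp_sub_left (a := 0) (b := π)
      (fun θ ↦ logNormLogDiv (circleMap 0 1 θ)) (2 * π)
    rw [sub_zero, show 2 * π - π = π by ring] at this
    rw [← this]
    apply intervalIntegral.integral_congr_ae
    filter_upwards [ae_one_add_circleMap_ne_zero] with θ hθ hmem
    rw [circleMap_two_pi_sub]
    refine logNormLogDiv_conj (by simp) (hθ ?_)
    rw [Set.uIoc_of_le hpi.le] at hmem
    rw [Set.uIoc_of_le two_pi_pos.le]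
    exact ⟨hmem.1, by linarith [hmem.2]⟩
  rw [hrefl, integral_logNormLogDiv_circleMap] at hadd
  linarith

lemma log_one_add_circleMap_two_mul {x : ℝ} (hx : x ∈ Set.Ioo (-(π / 2)) (π / 2)) :
    Complex.log (1 + circleMap 0 1 (2 * x)) =
      (Real.log (2 * Real.cos x) : ℝ) + (x : ℂ) * Complex.I := by
  have hcos : 0 < 2 * Real.cos x := mul_pos two_pos (Real.cos_pos_of_mem_Ioo hx)
  have hfac : 1 + circleMap 0 1 (2 * x) =
      ((2 * Real.cos x : ℝ) : ℂ) * Complex.exp (x * Complex.I) := by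
    have h2 : Complex.exp (2 * x * Complex.I) = Complex.exp (x * Complex.I) ^ 2 := by
      rw [← Complex.exp_nat_mul]; push_cast; ring_nf
    have hinv : Complex.exp (-x * Complex.I) * Complex.exp (x * Complex.I) = 1 := by
      rw [← Complex.exp_add]; simp
    simp only [circleMap, zero_add, Complex.ofReal_one, one_mul, Complex.ofReal_mul,
      Complex.ofReal_ofNat, Complex.ofReal_cos, Complex.two_cos]
    rw [h2, add_mul, hinv]
    ring
  rw [hfac, Complex.log_ofReal_mul hcos (Complex.exp_ne_zero _), Complex.log_exp]
  · simpa using by linarith [hx.1, Real.pi_pos]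
  · simpa using by linarith [hx.2, Real.pi_pos]

lemma log_sq_add_log_two_mul_cos_sq {x : ℝ} (hx : x ∈ Set.Ioo (-(π / 2)) (π / 2)) :
    Real.log (x ^ 2 + Real.log (2 * Real.cos x) ^ 2) =
      2 * logNormLogDiv (circleMap 0 1 (2 * x)) := by
  rw [logNormLogDiv, norm_div, norm_circleMap_zero, abs_one, div_one,
    log_one_add_circleMap_two_mul hx, Complex.norm_add_mul_I, Real.log_sqrt (by positivity)]
  rw [add_comm]
  ring

theorem stmt_1 :
    ∫ x in (0:ℝ)..(π/2), Real.log (x^2 + (Real.log (2 * Real.cos x))^2) = 0 := by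
  have hcongr : ∫ x in (0 : ℝ)..(π / 2), Real.log (x ^ 2 + (Real.log (2 * Real.cos x)) ^ 2) =
      ∫ x in (0 : ℝ)..(π / 2), 2 * logNormLogDiv (circleMap 0 1 (2 * x)) := by
    apply intervalIntegral.integral_congr_ae
    filter_upwards [Measure.ae_ne volume (π / 2)] with x hx hmem
    rw [Set.uIoc_of_le (by positivity)] at hmem
    exact log_sq_add_log_two_mul_cos_sq
      ⟨by linarith [hmem.1, Real.pi_pos], lt_of_le_of_ne hmem.2 hx⟩
  rw [hcongr, intervalIntegral.integral_const_mul,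
    intervalIntegral.integral_comp_mul_left (fun θ ↦ logNormLogDiv (circleMap 0 1 θ)) two_ne_zero,
    mul_zero, mul_div_cancel₀ π two_ne_zero, integral_logNormLogDiv_half_circle]
  simp
end

section
/- For every r > ln 2, ∫_0^{π/2} ln((r²/(2π²)) · (cosh(2πx/r) - cos(2π ln(2 cos x)/r)) / (x² + ln²(2 cos x))) dx = -π · ln ∏_{n=1}^∞ (1 - e^{-r n}). -/
open Real

open Metric Set Filter Topology MeasureTheory

/-- The factor of `sinc (log (1 + u))` vanishing at `log (1 + u) = ±c`. -/
noncomputable def logFactor (c : ℝ) (u : ℂ) : ℂ := 1 - Complex.log (1 + u) ^ 2 / (c : ℂ) ^ 2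

lemma one_add_mem_slitPlane {u : ℂ} (hu : ‖u‖ < 1) : 1 + u ∈ Complex.slitPlane :=
  Complex.mem_slitPlane_of_norm_lt_one hu

lemma logFactor_eq_mul {c : ℝ} (hc : c ≠ 0) (u : ℂ) :
    logFactor c u = (1 - Complex.log (1 + u) / c) * (1 + Complex.log (1 + u) / c) := by
  have : (c : ℂ) ≠ 0 := by exact_mod_cast hc
  unfold logFactor
  field_simp
  ring

lemma re_log_one_add_le {u : ℂ} (hu : ‖u‖ ≤ 1) : (Complex.log (1 + u)).re ≤ Real.log 2 := by
  rw [Complex.log_re]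
  rcases eq_or_ne (1 + u) 0 with h | h
  · simp [h, Real.log_nonneg]
  · apply Real.log_le_log (by positivity)
    calc ‖1 + u‖ ≤ ‖(1 : ℂ)‖ + ‖u‖ := norm_add_le _ _
      _ ≤ 2 := by rw [norm_one]; linarith

lemma le_norm_one_sub_log_div {c : ℝ} (hc : Real.log 2 < c) {u : ℂ} (hu : ‖u‖ ≤ 1) :
    1 - Real.log 2 / c ≤ ‖1 - Complex.log (1 + u) / c‖ := by
  have hc0 : 0 < c := (Real.log_pos one_lt_two).trans hc
  refine le_trans ?_ (Complex.re_le_norm _)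
  simp only [Complex.sub_re, Complex.one_re, Complex.div_ofReal_re]
  gcongr
  exact re_log_one_add_le hu

lemma le_norm_one_add_log_div {c : ℝ} (hc : 0 < c) {u : ℂ} (hu' : 1 - rexp (-c) / 2 ≤ ‖u‖)
    (hu0 : 1 + u ≠ 0) :
    1 / (4 * c) ≤ ‖1 + Complex.log (1 + u) / c‖ := by
  have hcc : (c : ℂ) ≠ 0 := by exact_mod_cast hc.ne'
  set z := Complex.log (1 + u) with hz
  have key : 1 / 4 ≤ ‖z + c‖ := by
    rcases le_total 1 ‖z + c‖ with h | h
    · linarith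
    have h1 := Complex.norm_exp_sub_one_le h
    have h2 : u = Complex.exp (-c) * (Complex.exp (z + c) - 1) + (Complex.exp (-c) - 1) := by
      rw [mul_sub, ← Complex.exp_add, show -(c : ℂ) + (z + c) = z by ring, hz, Complex.exp_log hu0]
      ring
    have h3 : ‖Complex.exp (-c)‖ = rexp (-c) := by simp [Complex.norm_exp]
    have h4 : ‖Complex.exp (-c) - 1‖ = 1 - rexp (-c) := by
      rw [show Complex.exp (-c) - 1 = ((rexp (-c) - 1 : ℝ) : ℂ) by push_cast; rfl,
        Complex.norm_real, Real.norm_eq_abs, abs_sub_comm, abs_of_nonneg]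
      have : rexp (-c) ≤ 1 := Real.exp_le_one_iff.mpr (by linarith)
      linarith
    have h5 : ‖u‖ ≤ rexp (-c) * (2 * ‖z + c‖) + (1 - rexp (-c)) := by
      calc ‖u‖ = ‖Complex.exp (-c) * (Complex.exp (z + c) - 1) + (Complex.exp (-c) - 1)‖ := by
            rw [← h2]
        _ ≤ _ := norm_add_le _ _
        _ ≤ _ := by rw [norm_mul, h3, h4]; gcongr
    have h6 := Real.exp_pos (-c)
    by_contra! h7
    nlinarith
  rw [show 1 + z / c = (z + c) / c by field_simp; ring, norm_div, Complex.norm_real,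
    Real.norm_of_nonneg hc.le, div_le_div_iff₀ (by positivity) hc]
  nlinarith

/-- A positive lower bound for `logFactor c` near the unit circle. -/
noncomputable def logFactorBound (c : ℝ) : ℝ := (1 - Real.log 2 / c) * (1 / (4 * c))

lemma logFactorBound_pos {c : ℝ} (hc : Real.log 2 < c) : 0 < logFactorBound c := by
  have hc0 : 0 < c := (Real.log_pos one_lt_two).trans hc
  have : Real.log 2 / c < 1 := (div_lt_one hc0).mpr hc
  exact mul_pos (by linarith) (by positivity)

lemma logFactorBound_le {c : ℝ} (hc : Real.log 2 < c) {u : ℂ} (hu : ‖u‖ ≤ 1)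
    (hu' : 1 - rexp (-c) / 2 ≤ ‖u‖) (hu0 : 1 + u ≠ 0) :
    logFactorBound c ≤ ‖logFactor c u‖ := by
  have hc0 : 0 < c := (Real.log_pos one_lt_two).trans hc
  rw [logFactor_eq_mul hc0.ne', norm_mul]
  exact mul_le_mul (le_norm_one_sub_log_div hc hu) (le_norm_one_add_log_div hc0 hu' hu0)
    (by positivity) (norm_nonneg _)

lemma log_norm_logFactor_le (c : ℝ) (u : ℂ) :
    Real.log ‖logFactor c u‖ ≤ ‖Complex.log (1 + u)‖ ^ 2 / c ^ 2 := by
  have h1 : ‖logFactor c u‖ ≤ 1 + ‖Complex.log (1 + u)‖ ^ 2 / c ^ 2 := by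
    refine (norm_sub_le _ _).trans (le_of_eq ?_)
    simp
  rcases eq_or_ne (logFactor c u) 0 with h | h
  · rw [h, norm_zero, Real.log_zero]; positivity
  · calc Real.log ‖logFactor c u‖ ≤ ‖logFactor c u‖ - 1 :=
        Real.log_le_sub_one_of_pos (norm_pos_iff.mpr h)
      _ ≤ _ := by linarith

lemma abs_log_norm_logFactor_le {c : ℝ} (hc : Real.log 2 < c) {u : ℂ} (hu : ‖u‖ ≤ 1)
    (hu' : 1 - rexp (-c) / 2 ≤ ‖u‖) (hu0 : 1 + u ≠ 0) :
    |Real.log ‖logFactor c u‖| ≤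
      |Real.log (logFactorBound c)| + ‖Complex.log (1 + u)‖ ^ 2 / c ^ 2 := by
  have h1 := log_norm_logFactor_le c u
  have h2 := Real.log_le_log (logFactorBound_pos hc) (logFactorBound_le hc hu hu' hu0)
  have h3 : 0 ≤ ‖Complex.log (1 + u)‖ ^ 2 / c ^ 2 := by positivity
  have h4 := neg_abs_le (Real.log (logFactorBound c))
  have h5 := abs_nonneg (Real.log (logFactorBound c))
  exact abs_le.mpr ⟨by linarith, by linarith⟩

lemma logFactor_eq_zero_iff {c : ℝ} (hc : Real.log 2 < c) {u : ℂ} (hu : ‖u‖ < 1) :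
    logFactor c u = 0 ↔ u = ((rexp (-c) - 1 : ℝ) : ℂ) := by
  have hc0 : 0 < c := (Real.log_pos one_lt_two).trans hc
  have hcc : (c : ℂ) ≠ 0 := by exact_mod_cast hc0.ne'
  have h0 : 1 - Complex.log (1 + u) / c ≠ 0 := by
    rw [← norm_pos_iff]
    refine lt_of_lt_of_le ?_ (le_norm_one_sub_log_div hc hu.le)
    have : Real.log 2 / c < 1 := (div_lt_one hc0).mpr hc
    linarith
  rw [logFactor_eq_mul hc0.ne', mul_eq_zero, or_iff_right h0]
  constructor
  · intro h
    have h1 : Complex.log (1 + u) = -c := by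
      field_simp at h
      linear_combination h
    have h2 := Complex.exp_log (Complex.slitPlane_ne_zero (one_add_mem_slitPlane hu))
    rw [h1] at h2
    push_cast
    rw [h2]; ring
  · rintro rfl
    rw [show (1 : ℂ) + ((rexp (-c) - 1 : ℝ) : ℂ) = ((rexp (-c) : ℝ) : ℂ) by push_cast; ring,
      ← Complex.ofReal_log (Real.exp_pos _).le, Real.log_exp]
    push_cast
    field_simp
    ring

lemma hasDerivAt_logFactor (c : ℝ) {u : ℂ} (hu : ‖u‖ < 1) :
    HasDerivAt (logFactor c) (-(2 * Complex.log (1 + u) * (1 / (1 + u)) / (c : ℂ) ^ 2)) u := by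
  have h := ((((hasDerivAt_id u).const_add 1).clog (one_add_mem_slitPlane hu)).pow 2).div_const
    ((c : ℂ) ^ 2) |>.const_sub 1
  refine h.congr_deriv ?_
  simp

lemma circleAverage_log_norm_logFactor {c : ℝ} (hc : Real.log 2 < c) {R : ℝ}
    (hR : 1 - rexp (-c) < R) (hR1 : R < 1) :
    circleAverage (fun u ↦ Real.log ‖logFactor c u‖) 0 R =
      Real.log R - Real.log (1 - rexp (-c)) := by
  have hc0 : 0 < c := (Real.log_pos one_lt_two).trans hc
  have hcc : (c : ℂ) ≠ 0 := by exact_mod_cast hc0.ne'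
  have he0 := Real.exp_pos (-c)
  have he1 : rexp (-c) < 1 := Real.exp_lt_one_iff.mpr (by linarith)
  have hR0 : 0 < R := by linarith
  set a : ℂ := ((rexp (-c) - 1 : ℝ) : ℂ) with ha
  have hna : ‖a‖ = 1 - rexp (-c) := by
    rw [ha, Complex.norm_real, Real.norm_eq_abs, abs_sub_comm, abs_of_nonneg (by linarith)]
  have ha1 : ‖a‖ < 1 := by linarith
  have hGa : logFactor c a = 0 := (logFactor_eq_zero_iff hc ha1).mpr rfl
  set g := dslope (logFactor c) a with hg
  have hGg : ∀ u, logFactor c u = (u - a) * g u := fun u ↦ by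
    have := sub_smul_dslope (logFactor c) a u
    rw [hGa, sub_zero, smul_eq_mul] at this
    exact this.symm
  have hdiff : DifferentiableOn ℂ g (ball 0 1) := by
    refine (Complex.differentiableOn_dslope (isOpen_ball.mem_nhds (by simpa using ha1))).mpr ?_
    intro u hu
    exact (hasDerivAt_logFactor c (by simpa using hu)).differentiableAt.differentiableWithinAt
  have hsub : closedBall (0 : ℂ) |R| ⊆ ball 0 1 := by
    rw [abs_of_pos hR0]; exact closedBall_subset_ball hR1
  have hgan : AnalyticOnNhd ℂ g (closedBall 0 |R|) :=
    (hdiff.analyticOnNhd isOpen_ball).mono hsub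
  have hg0 : ∀ u ∈ closedBall (0 : ℂ) |R|, g u ≠ 0 := by
    intro u hu h
    have hu1 : ‖u‖ < 1 := by simpa using hsub hu
    have hua : u = a := (logFactor_eq_zero_iff hc hu1).mp (by rw [hGg, h, mul_zero])
    rw [hua, hg, dslope_same, (hasDerivAt_logFactor c ha1).deriv,
      show (1 : ℂ) + a = ((rexp (-c) : ℝ) : ℂ) by rw [ha]; push_cast; ring,
      ← Complex.ofReal_log (Real.exp_pos _).le, Real.log_exp] at h
    simp [hc0.ne'] at h
  have hav := hgan.circleAverage_log_norm_of_ne_zero hg0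
  have hav' := circleAverage_log_norm_sub_const_of_mem_closedBall (c := 0) (R := R) (a := a)
    (by simp [abs_of_pos hR0, hna, hR.le])
  have hg00 : Real.log ‖g 0‖ = - Real.log (1 - rexp (-c)) := by
    have h1 := hGg 0
    have h2 : logFactor c 0 = 1 := by simp [logFactor]
    have h3 : ‖a‖ * ‖g 0‖ = 1 := by
      rw [← norm_mul, ← norm_neg, ← neg_mul]
      rw [h2, zero_sub] at h1
      rw [← h1, norm_one]
    rw [← hna, ← Real.log_inv]
    congr 1
    exact (eq_inv_of_mul_eq_one_right h3)
  have hcongr : circleAverage (fun u ↦ Real.log ‖logFactor c u‖) 0 R =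
      circleAverage (fun u ↦ Real.log ‖u - a‖ + Real.log ‖g u‖) 0 R := by
    refine circleAverage_congr_sphere fun u hu ↦ ?_
    have huR : ‖u‖ = R := by simpa [abs_of_pos hR0] using hu
    have hua : u - a ≠ 0 := by
      intro h
      rw [sub_eq_zero.mp h] at huR
      linarith
    have := hg0 u (sphere_subset_closedBall hu)
    simp only [hGg u, norm_mul]
    rw [Real.log_mul (norm_ne_zero_iff.mpr hua) (norm_ne_zero_iff.mpr this)]
  rw [hcongr, circleAverage_fun_add, hav, hav', hg00]
  · ring
  · exact MeromorphicOn.circleIntegrable_log_norm (f := fun u ↦ u - a) (by intro; fun_prop)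
  · exact (hgan.mono sphere_subset_closedBall).meromorphicOn.circleIntegrable_log_norm

/-- The boundary value `log (1 + exp (2 * x * I))` for `|x| < π / 2`. -/
noncomputable def boundaryLog (x : ℝ) : ℂ := (Real.log (2 * Real.cos x) : ℂ) + x * Complex.I

lemma exp_boundaryLog {x : ℝ} (hx : x ∈ Ioo (-(π / 2)) (π / 2)) :
    Complex.exp (boundaryLog x) = 1 + circleMap 0 1 (2 * x) := by
  have hcos := Real.cos_pos_of_mem_Ioo hx
  rw [boundaryLog, Complex.exp_add, ← Complex.ofReal_exp, Real.exp_log (by positivity), circleMap]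
  have h1 : Complex.exp (((2 * x : ℝ) : ℂ) * Complex.I) =
      Complex.exp (x * Complex.I) * Complex.exp (x * Complex.I) := by
    rw [← Complex.exp_add]; push_cast; ring_nf
  have h2 : Complex.exp (-x * Complex.I) * Complex.exp (x * Complex.I) = 1 := by
    rw [← Complex.exp_add]; simp
  rw [h1]
  push_cast
  rw [Complex.two_cos]
  linear_combination h2

lemma log_one_add_circleMap {x : ℝ} (hx : x ∈ Ioo (-(π / 2)) (π / 2)) :
    Complex.log (1 + circleMap 0 1 (2 * x)) = boundaryLog x := by
  have hpi := Real.pi_pos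
  have him : (boundaryLog x).im = x := by simp [boundaryLog]
  rw [← exp_boundaryLog hx, Complex.log_exp]
  · rw [him]; linarith [hx.1]
  · rw [him]; linarith [hx.2]

lemma logFactor_circleMap_one (c : ℝ) {x : ℝ} (hx : x ∈ Ioo (-(π / 2)) (π / 2)) :
    logFactor c (circleMap 0 1 (2 * x)) = 1 - boundaryLog x ^ 2 / (c : ℂ) ^ 2 := by
  rw [logFactor, log_one_add_circleMap hx]

lemma boundaryLog_neg (x : ℝ) : boundaryLog (-x) = (starRingEnd ℂ) (boundaryLog x) := by
  simp only [boundaryLog, map_add, map_mul, Complex.conj_ofReal, Complex.conj_I, Real.cos_neg]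
  push_cast; ring

lemma norm_one_sub_boundaryLog_neg (c x : ℝ) :
    ‖1 - boundaryLog (-x) ^ 2 / (c : ℂ) ^ 2‖ = ‖1 - boundaryLog x ^ 2 / (c : ℂ) ^ 2‖ := by
  rw [boundaryLog_neg, ← Complex.norm_conj (1 - boundaryLog x ^ 2 / (c : ℂ) ^ 2)]
  simp

lemma measurable_boundaryLog : Measurable boundaryLog := by
  unfold boundaryLog
  fun_prop

lemma cos_sq_le_norm_one_add_circleMap_sq {R : ℝ} (hR : 1 / 4 ≤ R) (x : ℝ) :
    Real.cos x ^ 2 ≤ ‖1 + circleMap 0 R (2 * x)‖ ^ 2 := by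
  have h : ‖1 + circleMap 0 R (2 * x)‖ ^ 2 = (1 - R) ^ 2 + 4 * R * Real.cos x ^ 2 := by
    rw [← Complex.normSq_eq_norm_sq, Complex.normSq_apply]
    simp only [Complex.add_re, Complex.add_im, Complex.one_re, Complex.one_im, circleMap_zero_re,
      circleMap_zero_im, Real.cos_two_mul, Real.sin_two_mul]
    linear_combination (4 * R ^ 2 * Real.cos x ^ 2) * Real.sin_sq_add_cos_sq x
  rw [h]
  nlinarith [sq_nonneg (1 - R), sq_nonneg (Real.cos x)]

lemma norm_log_one_add_circleMap_sq_le {R : ℝ} (hR : 1 / 4 ≤ R) (hR1 : R ≤ 1) {x : ℝ}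
    (hx : x ∈ Ioo (-(π / 2)) (π / 2)) :
    ‖Complex.log (1 + circleMap 0 R (2 * x))‖ ^ 2 ≤ 12 + 2 * Real.log (Real.cos x) ^ 2 := by
  have hcos := Real.cos_pos_of_mem_Ioo hx
  set u := circleMap 0 R (2 * x) with hu
  have hnu : ‖u‖ ≤ 1 := by rw [hu, norm_circleMap_zero, abs_of_nonneg (by linarith)]; exact hR1
  have hle : Real.cos x ≤ ‖1 + u‖ :=
    (sq_le_sq₀ hcos.le (norm_nonneg _)).mp (cos_sq_le_norm_one_add_circleMap_sq hR x)
  have hre1 := re_log_one_add_le hnu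
  have hre2 : Real.log (Real.cos x) ≤ (Complex.log (1 + u)).re := by
    rw [Complex.log_re]
    exact Real.log_le_log hcos hle
  have hl0 : Real.log (Real.cos x) ≤ 0 := Real.log_nonpos hcos.le (Real.cos_le_one x)
  have hl2 : Real.log 2 < 1 := by linarith [Real.log_two_lt_d9]
  have him : (Complex.log (1 + u)).im ^ 2 ≤ 10 := by
    have h1 := Complex.abs_arg_le_pi (1 + u)
    rw [← Complex.log_im] at h1
    have h2 := Real.pi_lt_d2
    rw [← sq_abs]
    nlinarith [abs_nonneg (Complex.log (1 + u)).im]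
  rw [← Complex.normSq_eq_norm_sq, Complex.normSq_apply]
  have hre : (Complex.log (1 + u)).re ^ 2 ≤ 1 + Real.log (Real.cos x) ^ 2 := by
    rcases le_total 0 (Complex.log (1 + u)).re with h | h <;> nlinarith
  nlinarith [sq_nonneg (Real.log (Real.cos x))]

lemma norm_boundaryLog_sq_le {x : ℝ} (hx : x ∈ Ioo (-(π / 2)) (π / 2)) :
    ‖boundaryLog x‖ ^ 2 ≤ 12 + 2 * Real.log (Real.cos x) ^ 2 := by
  rw [← log_one_add_circleMap hx]
  exact norm_log_one_add_circleMap_sq_le (by norm_num) le_rfl hx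

lemma log_sq_le_rpow {y : ℝ} (h0 : 0 < y) (h1 : y ≤ 1) :
    Real.log y ^ 2 ≤ 16 * y ^ (-(1 / 2) : ℝ) := by
  have h := (Real.abs_log_mul_self_rpow_lt y (1 / 4) h0 h1 (by norm_num)).le
  have h2 : (Real.log y * y ^ (1 / 4 : ℝ)) ^ 2 ≤ 16 := by
    rw [← sq_abs]
    nlinarith [abs_nonneg (Real.log y * y ^ (1 / 4 : ℝ))]
  have h3 : (y ^ (1 / 4 : ℝ)) ^ 2 * y ^ (-(1 / 2) : ℝ) = 1 := by
    rw [← Real.rpow_natCast, ← Real.rpow_mul h0.le, ← Real.rpow_add h0]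
    norm_num
  have h4 : 0 < y ^ (-(1 / 2) : ℝ) := Real.rpow_pos_of_pos h0 _
  calc Real.log y ^ 2 = (Real.log y * y ^ (1 / 4 : ℝ)) ^ 2 * y ^ (-(1 / 2) : ℝ) := by
        rw [mul_pow, mul_assoc, h3, mul_one]
    _ ≤ _ := by gcongr

lemma ae_ne_real (a : ℝ) : ∀ᵐ x : ℝ, x ≠ a :=
  compl_mem_ae_iff.mpr (measure_singleton a)

lemma intervalIntegrable_log_cos_sq :
    IntervalIntegrable (fun x ↦ Real.log (Real.cos x) ^ 2) volume (-(π / 2)) (π / 2) := by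
  have hpi := Real.pi_pos
  have hmeas : Measurable fun x ↦ Real.log (Real.cos x) ^ 2 := by fun_prop
  have h0 : IntervalIntegrable (fun x ↦ Real.log (Real.cos x) ^ 2) volume 0 (π / 2) := by
    have hdom : IntervalIntegrable (fun x : ℝ ↦ 16 * (1 - 2 / π * x) ^ (-(1 / 2) : ℝ))
        volume 0 (π / 2) := by
      have h := (intervalIntegral.intervalIntegrable_rpow' (r := -(1 / 2)) (a := 1) (b := 0)
        (by norm_num)).const_mul 16
      have h' := (h.comp_sub_left 1).comp_mul_left (c := 2 / π)
      convert h' using 1 <;> field_simp <;> simp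
    refine hdom.mono_fun hmeas.aestronglyMeasurable ?_
    rw [Filter.EventuallyLE, ae_restrict_iff' measurableSet_uIoc]
    filter_upwards [ae_ne_real (π / 2)] with x hne hx
    rw [uIoc_of_le (by positivity)] at hx
    have hlt : x < π / 2 := lt_of_le_of_ne hx.2 hne
    have h1 : 0 < 1 - 2 / π * x := by
      rw [sub_pos, div_mul_eq_mul_div, div_lt_one hpi]; linarith
    have h2 := Real.one_sub_mul_le_cos hx.1.le hx.2
    have h3 := log_sq_le_rpow (h1.trans_le h2) (Real.cos_le_one x)
    rw [Real.norm_of_nonneg (sq_nonneg _), Real.norm_of_nonneg (by positivity)]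
    refine h3.trans ?_
    gcongr 16 * ?_
    exact Real.rpow_le_rpow_of_nonpos h1 h2 (by norm_num)
  refine IntervalIntegrable.trans (b := 0) ?_ h0
  have h := h0.comp_mul_left (c := -1)
  simp only [neg_mul, one_mul, Real.cos_neg, div_neg, div_one, neg_zero] at h
  exact h.symm

lemma integral_circleMap_two_mul (f : ℂ → ℝ) (R : ℝ) :
    ∫ x in (-(π / 2))..(π / 2), f (circleMap 0 R (2 * x)) = π * circleAverage f 0 R := by
  have hpi := Real.pi_pos
  rw [circleAverage_eq_integral_add (-π),
    intervalIntegral.integral_comp_add_right (fun θ ↦ f (circleMap 0 R θ)),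
    intervalIntegral.integral_comp_mul_left (fun θ ↦ f (circleMap 0 R θ)) two_ne_zero]
  rw [show 2 * -(π / 2) = 0 + -π by ring, show 2 * (π / 2) = 2 * π + -π by ring]
  simp only [smul_eq_mul]
  field_simp

lemma one_sub_boundaryLog_ne_zero {c : ℝ} (hc : Real.log 2 < c) {x : ℝ} :
    1 - boundaryLog x ^ 2 / (c : ℂ) ^ 2 ≠ 0 := by
  have hl2 := Real.log_pos one_lt_two
  have hcc : (c : ℂ) ≠ 0 := by exact_mod_cast (hl2.trans hc).ne'
  intro h
  have h1 : (boundaryLog x - c) * (boundaryLog x + c) = 0 := by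
    field_simp at h
    linear_combination -h
  have him : (boundaryLog x).im = x := by simp [boundaryLog]
  have hre : (boundaryLog x).re = Real.log (2 * Real.cos x) := by simp [boundaryLog]
  rcases mul_eq_zero.mp h1 with h2 | h2
  all_goals
    have h3 := congrArg Complex.im h2
    have h4 := congrArg Complex.re h2
    simp [him, hre] at h3 h4
    rw [h3] at h4
    simp at h4
    linarith

lemma abs_log_norm_boundary_le {c : ℝ} (hc : Real.log 2 < c) {x : ℝ}
    (hx : x ∈ Ioo (-(π / 2)) (π / 2)) :
    |Real.log ‖1 - boundaryLog x ^ 2 / (c : ℂ) ^ 2‖| ≤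
      |Real.log (logFactorBound c)| + (12 + 2 * Real.log (Real.cos x) ^ 2) / c ^ 2 := by
  have h := abs_log_norm_logFactor_le hc (u := circleMap 0 1 (2 * x)) (by simp)
    (by simp; positivity) (by rw [← exp_boundaryLog hx]; exact Complex.exp_ne_zero _)
  rw [logFactor_circleMap_one c hx, log_one_add_circleMap hx] at h
  refine h.trans ?_
  gcongr
  exact norm_boundaryLog_sq_le hx

lemma log_norm_boundary_le (c : ℝ) {x : ℝ} (hx : x ∈ Ioo (-(π / 2)) (π / 2)) :
    Real.log ‖1 - boundaryLog x ^ 2 / (c : ℂ) ^ 2‖ ≤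
      (12 + 2 * Real.log (Real.cos x) ^ 2) / c ^ 2 := by
  have h := log_norm_logFactor_le c (circleMap 0 1 (2 * x))
  rw [logFactor_circleMap_one c hx, log_one_add_circleMap hx] at h
  refine h.trans ?_
  gcongr
  exact norm_boundaryLog_sq_le hx

lemma ae_mem_Ioo_of_mem_uIoc :
    ∀ᵐ x : ℝ, x ∈ uIoc (-(π / 2)) (π / 2) → x ∈ Ioo (-(π / 2)) (π / 2) := by
  filter_upwards [ae_ne_real (π / 2)] with x hne hx
  rw [uIoc_of_le (by linarith [Real.pi_pos])] at hx
  exact ⟨hx.1, lt_of_le_of_ne hx.2 hne⟩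

lemma intervalIntegrable_log_norm_boundary {c : ℝ} (hc : Real.log 2 < c) :
    IntervalIntegrable (fun x ↦ Real.log ‖1 - boundaryLog x ^ 2 / (c : ℂ) ^ 2‖) volume
      (-(π / 2)) (π / 2) := by
  have hdom : IntervalIntegrable (fun x ↦ |Real.log (logFactorBound c)| +
      (12 + 2 * Real.log (Real.cos x) ^ 2) / c ^ 2) volume (-(π / 2)) (π / 2) :=
    intervalIntegrable_const.add
      ((intervalIntegrable_const.add (intervalIntegrable_log_cos_sq.const_mul 2)).div_const _)
  have hm := measurable_boundaryLog
  refine hdom.mono_fun (Measurable.aestronglyMeasurable (by fun_prop)) ?_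
  rw [Filter.EventuallyLE, ae_restrict_iff' measurableSet_uIoc]
  filter_upwards [ae_mem_Ioo_of_mem_uIoc] with x hx hx'
  exact (abs_log_norm_boundary_le hc (hx hx')).trans (le_abs_self _)

lemma integral_log_norm_boundary_symm {c : ℝ} (hc : Real.log 2 < c) :
    ∫ x in (-(π / 2))..(π / 2), Real.log ‖1 - boundaryLog x ^ 2 / (c : ℂ) ^ 2‖ =
      -π * Real.log (1 - rexp (-c)) := by
  have hc0 : 0 < c := (Real.log_pos one_lt_two).trans hc
  have he0 := Real.exp_pos (-c)
  have he1 : rexp (-c) < 1 := Real.exp_lt_one_iff.mpr (by linarith)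
  have hev : ∀ᶠ R in 𝓝[<] (1 : ℝ), R ∈ Ioo (1 - rexp (-c) / 2) 1 :=
    Ioo_mem_nhdsLT (by linarith)
  have hlim1 : Tendsto
      (fun R ↦ ∫ x in (-(π / 2))..(π / 2), Real.log ‖logFactor c (circleMap 0 R (2 * x))‖)
      (𝓝[<] 1) (𝓝 (-π * Real.log (1 - rexp (-c)))) := by
    have h : Tendsto (fun R ↦ π * (Real.log R - Real.log (1 - rexp (-c)))) (𝓝[<] 1)
        (𝓝 (π * (Real.log 1 - Real.log (1 - rexp (-c))))) :=
      (((Real.continuousAt_log one_ne_zero).tendsto.mono_left nhdsWithin_le_nhds).sub_const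
        _).const_mul _
    rw [Real.log_one, zero_sub, mul_neg, ← neg_mul] at h
    refine h.congr' ?_
    filter_upwards [hev] with R hR
    rw [integral_circleMap_two_mul (fun u ↦ Real.log ‖logFactor c u‖),
      circleAverage_log_norm_logFactor hc (by linarith [hR.1]) hR.2]
  refine tendsto_nhds_unique ?_ hlim1
  refine intervalIntegral.tendsto_integral_filter_of_dominated_convergence
    (fun x ↦ |Real.log (logFactorBound c)| + (12 + 2 * Real.log (Real.cos x) ^ 2) / c ^ 2)
    ?_ ?_ ?_ ?_
  · refine Eventually.of_forall fun R ↦ Measurable.aestronglyMeasurable ?_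
    have h1 : Measurable fun x : ℝ ↦ circleMap 0 R (2 * x) := by
      unfold circleMap; fun_prop
    unfold logFactor
    have h2 : Measurable fun x : ℝ ↦ Complex.log (1 + circleMap 0 R (2 * x)) :=
      (h1.const_add 1).clog
    fun_prop
  · filter_upwards [hev] with R hR
    filter_upwards [ae_mem_Ioo_of_mem_uIoc] with x hx hx'
    have hR0 : 0 < R := by linarith [hR.1]
    have hn : ‖circleMap 0 R (2 * x)‖ = R := by rw [norm_circleMap_zero, abs_of_pos hR0]
    refine (abs_log_norm_logFactor_le hc (by rw [hn]; exact hR.2.le) (by rw [hn]; exact hR.1.le)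
      (Complex.slitPlane_ne_zero (one_add_mem_slitPlane (by rw [hn]; exact hR.2)))).trans ?_
    gcongr
    exact norm_log_one_add_circleMap_sq_le (by linarith [hR.1]) hR.2.le (hx hx')
  · exact intervalIntegrable_const.add
      ((intervalIntegrable_const.add (intervalIntegrable_log_cos_sq.const_mul 2)).div_const _)
  · filter_upwards [ae_mem_Ioo_of_mem_uIoc] with x hx hx'
    have hx := hx hx'
    rw [← logFactor_circleMap_one c hx]
    have hne : logFactor c (circleMap 0 1 (2 * x)) ≠ 0 := by
      rw [logFactor_circleMap_one c hx]; exact one_sub_boundaryLog_ne_zero hc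
    have hslit : 1 + circleMap 0 1 (2 * x) ∈ Complex.slitPlane := by
      rw [Complex.mem_slitPlane_iff_arg, ← Complex.log_im, log_one_add_circleMap hx,
        ← exp_boundaryLog hx]
      refine ⟨?_, Complex.exp_ne_zero _⟩
      have : (boundaryLog x).im = x := by simp [boundaryLog]
      rw [this]
      linarith [hx.2, Real.pi_pos]
    have hcm : ContinuousAt (fun R : ℝ ↦ circleMap 0 R (2 * x)) 1 := by
      unfold circleMap; fun_prop
    have hcont : ContinuousAt (fun R : ℝ ↦ logFactor c (circleMap 0 R (2 * x))) 1 := by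
      unfold logFactor
      exact continuousAt_const.sub ((((continuousAt_const.add hcm).clog hslit).pow 2).div_const _)
    exact (hcont.norm.log (norm_ne_zero_iff.mpr hne)).tendsto.mono_left nhdsWithin_le_nhds

lemma integral_log_norm_boundary {c : ℝ} (hc : Real.log 2 < c) :
    ∫ x in (0 : ℝ)..(π / 2), Real.log ‖1 - boundaryLog x ^ 2 / (c : ℂ) ^ 2‖ =
      -(π / 2) * Real.log (1 - rexp (-c)) := by
  have hpi := Real.pi_pos
  have hint := intervalIntegrable_log_norm_boundary hc
  have h := integral_log_norm_boundary_symm hc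
  have hmem : (0 : ℝ) ∈ uIcc (-(π / 2)) (π / 2) := by
    rw [uIcc_of_le (by linarith)]; constructor <;> linarith
  rw [← intervalIntegral.integral_add_adjacent_intervals
    (hint.mono_set (uIcc_subset_uIcc_left hmem)) (hint.mono_set (uIcc_subset_uIcc_right hmem))] at h
  have hsymm := intervalIntegral.integral_comp_neg (a := 0) (b := π / 2)
    (fun x ↦ Real.log ‖1 - boundaryLog x ^ 2 / (c : ℂ) ^ 2‖)
  simp only [norm_one_sub_boundaryLog_neg, neg_zero] at hsymm
  rw [← hsymm] at h
  linarith

lemma tsum_log_norm_one_sub {w : ℂ} (hw : w.im ≠ 0) :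
    ∑' n : ℕ, Real.log ‖1 - w ^ 2 / ((n : ℂ) + 1) ^ 2‖ =
      Real.log (‖Complex.sin (π * w)‖ / ‖π * w‖) := by
  have hw0 : w ≠ 0 := by rintro rfl; simp at hw
  have hpi : (π : ℂ) ≠ 0 := by exact_mod_cast Real.pi_ne_zero
  have hsum : Summable fun n : ℕ ↦ Real.log ‖1 - w ^ 2 / ((n : ℂ) + 1) ^ 2‖ := by
    simp only [sub_eq_add_neg]
    refine Summable.summable_log_norm_one_add ?_
    have h := ((summable_nat_add_iff 1).mpr
      (Real.summable_one_div_nat_pow.mpr one_lt_two)).mul_left (‖w‖ ^ 2)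
    refine h.congr fun n ↦ ?_
    rw [norm_neg, norm_div, norm_pow, norm_pow,
      show (n : ℂ) + 1 = ((n + 1 : ℕ) : ℂ) by push_cast; rfl, Complex.norm_natCast]
    ring
  have hne (n : ℕ) : 1 - w ^ 2 / ((n : ℂ) + 1) ^ 2 ≠ 0 := by
    have hn : (n : ℂ) + 1 ≠ 0 := by exact_mod_cast n.succ_ne_zero
    intro h
    have h1 : (w - (n + 1)) * (w + (n + 1)) = 0 := by
      field_simp at h
      linear_combination -h
    rcases mul_eq_zero.mp h1 with h2 | h2 <;>
    · have := congrArg Complex.im h2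
      simp at this
      exact hw this
  have hsin : Complex.sin (π * w) ≠ 0 := by
    rw [Complex.sin_ne_zero_iff]
    intro k hk
    have : w = k := by
      apply mul_left_cancel₀ hpi
      rw [hk]; ring
    rw [this] at hw
    simp at hw
  have hlim := (Complex.tendsto_euler_sin_prod w).norm.div_const ‖(π : ℂ) * w‖
  have hlog := hlim.log (div_ne_zero (norm_ne_zero_iff.mpr hsin)
    (norm_ne_zero_iff.mpr (mul_ne_zero hpi hw0)))
  refine tendsto_nhds_unique hsum.hasSum.tendsto_sum_nat (hlog.congr fun n ↦ ?_)
  rw [norm_mul, mul_div_cancel_left₀ _ (norm_ne_zero_iff.mpr (mul_ne_zero hpi hw0)), norm_prod,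
    Real.log_prod fun i _ ↦ norm_ne_zero_iff.mpr (hne i)]

lemma two_mul_norm_sin_sq (a b : ℝ) :
    2 * ‖Complex.sin (a + b * Complex.I)‖ ^ 2 = Real.cosh (2 * b) - Real.cos (2 * a) := by
  rw [← Complex.normSq_eq_norm_sq, Complex.normSq_apply, Complex.sin_add_mul_I,
    ← Complex.ofReal_sin, ← Complex.ofReal_cos, ← Complex.ofReal_cosh, ← Complex.ofReal_sinh]
  simp only [Complex.add_re, Complex.add_im, Complex.mul_re, Complex.mul_im, Complex.ofReal_re,
    Complex.ofReal_im, Complex.I_re, Complex.I_im, Real.cosh_two_mul, Real.cos_two_mul]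
  have h1 := Real.cosh_sq b
  have h2 := Real.sin_sq a
  ring_nf
  rw [h1, h2]
  ring

lemma log_integrand_eq_two_mul_tsum {r : ℝ} (hr : 0 < r) {x : ℝ} (hx : 0 < x) :
    Real.log ((r ^ 2 / (2 * π ^ 2))
          * (Real.cosh (2 * π * x / r) - Real.cos (2 * π * Real.log (2 * Real.cos x) / r))
          / (x ^ 2 + (Real.log (2 * Real.cos x)) ^ 2)) =
      2 * ∑' n : ℕ, Real.log ‖1 - boundaryLog x ^ 2 / ((r * (n + 1) : ℝ) : ℂ) ^ 2‖ := by
  have hrr : (r : ℂ) ≠ 0 := by exact_mod_cast hr.ne'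
  have hpi := Real.pi_pos
  have him : (boundaryLog x / r).im ≠ 0 := by
    rw [Complex.div_ofReal_im]
    simp [boundaryLog, hx.ne', hr.ne']
  have h := tsum_log_norm_one_sub him
  have hterm (n : ℕ) : (boundaryLog x / r) ^ 2 / ((n : ℂ) + 1) ^ 2 =
      boundaryLog x ^ 2 / ((r * (n + 1) : ℝ) : ℂ) ^ 2 := by
    push_cast
    rw [div_pow, div_div, mul_pow]
  simp only [hterm] at h
  have hpow (y : ℝ) : 2 * Real.log y = Real.log (y ^ 2) := by
    rw [Real.log_pow, Nat.cast_ofNat]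
  rw [h, hpow]
  congr 1
  have hsin := two_mul_norm_sin_sq (π * Real.log (2 * Real.cos x) / r) (π * x / r)
  rw [show ((π * Real.log (2 * Real.cos x) / r : ℝ) : ℂ) + ((π * x / r : ℝ) : ℂ) * Complex.I =
    π * (boundaryLog x / r) by rw [boundaryLog]; push_cast; ring,
    show 2 * (π * x / r) = 2 * π * x / r by ring,
    show 2 * (π * Real.log (2 * Real.cos x) / r) = 2 * π * Real.log (2 * Real.cos x) / r by ring]
    at hsin
  have hnorm : ‖(π : ℂ) * (boundaryLog x / r)‖ ^ 2 =
      π ^ 2 / r ^ 2 * (x ^ 2 + Real.log (2 * Real.cos x) ^ 2) := by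
    rw [norm_mul, norm_div, Complex.norm_real, Complex.norm_real, mul_pow, div_pow,
      ← Complex.normSq_eq_norm_sq (boundaryLog x), Complex.normSq_apply]
    simp [boundaryLog]
    ring
  rw [← hsin, div_pow, hnorm]
  have : 0 < x ^ 2 + Real.log (2 * Real.cos x) ^ 2 := by positivity
  field_simp

lemma hasSum_integral_log_norm_boundary {r : ℝ} (hr : Real.log 2 < r) :
    HasSum (fun n : ℕ ↦ -(π / 2) * Real.log (1 - rexp (-r * (n + 1))))
      (∫ x in (0 : ℝ)..(π / 2),
        ∑' n : ℕ, Real.log ‖1 - boundaryLog x ^ 2 / ((r * (n + 1) : ℝ) : ℂ) ^ 2‖) := by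
  have hpi := Real.pi_pos
  have hr0 : 0 < r := (Real.log_pos one_lt_two).trans hr
  have hc (n : ℕ) : Real.log 2 < r * (n + 1) := by
    have : (0 : ℝ) ≤ n := n.cast_nonneg
    nlinarith
  have hmem : (0 : ℝ) ∈ uIcc (-(π / 2)) (π / 2) := by
    rw [uIcc_of_le (by linarith)]; constructor <;> linarith
  have hint (n : ℕ) :
      Integrable (fun x ↦ Real.log ‖1 - boundaryLog x ^ 2 / ((r * (n + 1) : ℝ) : ℂ) ^ 2‖)
        (volume.restrict (Ioc 0 (π / 2))) :=
    (intervalIntegrable_iff_integrableOn_Ioc_of_le (by positivity)).mp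
      ((intervalIntegrable_log_norm_boundary (hc n)).mono_set (uIcc_subset_uIcc_right hmem))
  have hval (n : ℕ) : ∫ x in Ioc 0 (π / 2),
      Real.log ‖1 - boundaryLog x ^ 2 / ((r * (n + 1) : ℝ) : ℂ) ^ 2‖ =
        -(π / 2) * Real.log (1 - rexp (-r * (n + 1))) := by
    rw [← intervalIntegral.integral_of_le (by positivity), integral_log_norm_boundary (hc n),
      neg_mul r]
  have hB : Integrable (fun x ↦ 12 + 2 * Real.log (Real.cos x) ^ 2)
      (volume.restrict (Ioc 0 (π / 2))) :=
    (intervalIntegrable_iff_integrableOn_Ioc_of_le (by positivity)).mp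
      ((intervalIntegrable_const.add (intervalIntegrable_log_cos_sq.const_mul 2)).mono_set
        (uIcc_subset_uIcc_right hmem))
  set K := ∫ x in Ioc 0 (π / 2), (12 + 2 * Real.log (Real.cos x) ^ 2) with hK
  have hnorm (n : ℕ) : ∫ x in Ioc 0 (π / 2),
      ‖Real.log ‖1 - boundaryLog x ^ 2 / ((r * (n + 1) : ℝ) : ℂ) ^ 2‖‖ ≤
        2 * K / r ^ 2 * (1 / ((n + 1 : ℕ) : ℝ) ^ 2) := by
    have hpos : 0 ≤ -(π / 2) * Real.log (1 - rexp (-r * (n + 1))) := by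
      have h0 := Real.exp_pos (-r * (n + 1))
      have h1 : rexp (-r * (n + 1)) ≤ 1 := Real.exp_le_one_iff.mpr (by
        have : (0 : ℝ) ≤ n := n.cast_nonneg
        nlinarith)
      exact mul_nonneg_of_nonpos_of_nonpos (by linarith)
        (Real.log_nonpos (by linarith) (by linarith))
    calc _ ≤ ∫ x in Ioc 0 (π / 2), (2 * (12 + 2 * Real.log (Real.cos x) ^ 2) / (r * (n + 1)) ^ 2 -
          Real.log ‖1 - boundaryLog x ^ 2 / ((r * (n + 1) : ℝ) : ℂ) ^ 2‖) := by
          refine integral_mono_ae (hint n).norm (((hB.const_mul 2).div_const _).sub (hint n)) ?_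
          rw [Filter.EventuallyLE, ae_restrict_iff' measurableSet_Ioc]
          filter_upwards [ae_ne_real (π / 2)] with x hne hx
          have hx' : x ∈ Ioo (-(π / 2)) (π / 2) :=
            ⟨by linarith [hx.1], lt_of_le_of_ne hx.2 hne⟩
          have h1 := log_norm_boundary_le (r * (n + 1)) hx'
          have h2 : 0 ≤ (12 + 2 * Real.log (Real.cos x) ^ 2) / (r * (n + 1)) ^ 2 := by positivity
          rw [mul_div_assoc, Real.norm_eq_abs]
          exact abs_le.mpr ⟨by linarith, by linarith⟩
      _ = 2 * K / (r * (n + 1)) ^ 2 - -(π / 2) * Real.log (1 - rexp (-r * (n + 1))) := by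
          rw [integral_sub ((hB.const_mul 2).div_const _) (hint n), hval, integral_div,
            integral_const_mul]
      _ ≤ 2 * K / (r * (n + 1)) ^ 2 := by linarith
      _ = _ := by push_cast; field_simp
  have hsummable : Summable fun n : ℕ ↦ ∫ x in Ioc 0 (π / 2),
      ‖Real.log ‖1 - boundaryLog x ^ 2 / ((r * (n + 1) : ℝ) : ℂ) ^ 2‖‖ := by
    refine Summable.of_nonneg_of_le (fun n ↦ integral_nonneg fun x ↦ norm_nonneg _) hnorm ?_
    exact ((summable_nat_add_iff 1).mpr
      (Real.summable_one_div_nat_pow.mpr one_lt_two)).mul_left _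
  have h := hasSum_integral_of_summable_integral_norm hint hsummable
  simp only [hval] at h
  rwa [intervalIntegral.integral_of_le (by positivity)]

theorem stmt_4 (r : ℝ) (hr : Real.log 2 < r) :
    ∫ x in (0:ℝ)..(π/2),
        Real.log ((r^2 / (2 * π^2))
          * (Real.cosh (2 * π * x / r) - Real.cos (2 * π * Real.log (2 * Real.cos x) / r))
          / (x^2 + (Real.log (2 * Real.cos x))^2))
      = -π * Real.log (∏' n : ℕ, (1 - Real.exp (-r * (n+1)))) := by
  have hpi := Real.pi_pos
  have hr0 : 0 < r := (Real.log_pos one_lt_two).trans hr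
  have hsum := hasSum_integral_log_norm_boundary hr
  have hlog : Summable fun n : ℕ ↦ Real.log (1 - rexp (-r * (n + 1))) :=
    (summable_mul_left_iff (by linarith : -(π / 2) ≠ 0)).mp hsum.summable
  have hpos (n : ℕ) : 0 < 1 - rexp (-r * (n + 1)) := by
    rw [sub_pos, Real.exp_lt_one_iff]
    have : (0 : ℝ) ≤ n := n.cast_nonneg
    nlinarith
  rw [← Real.rexp_tsum_eq_tprod hpos hlog, Real.log_exp]
  have hcongr := intervalIntegral.integral_congr_ae (μ := volume) (a := 0) (b := π / 2)
    (Eventually.of_forall fun x hx ↦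
      log_integrand_eq_two_mul_tsum hr0 (x := x) (by rw [uIoc_of_le (by positivity)] at hx; exact hx.1))
  rw [hcongr, intervalIntegral.integral_const_mul, ← hsum.tsum_eq, tsum_mul_left]
  ring
end

section
/- For every α > (ln 2)/(2π), ∫_0^{π/2} ln(cosh(x/α) - cos(ln(2 cos x)/α)) dx = -(π/2)·ln(2α²) - π·ln ∏_{n=1}^∞ (1 - e^{-2παn}). -/
open Real Filter Topology MeasureTheory

/-- Jensen's formula for an analytic function with only simple zeros, one of them at the centre. -/
theorem circleAverage_log_norm_of_simple_zeros {f : ℂ → ℂ} {r : ℝ} (hr : 0 < r)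
    (hf : AnalyticOnNhd ℂ f (Metric.closedBall 0 r)) (S : Finset ℂ)
    (hS : ∀ z, z ∈ S ↔ z ∈ Metric.closedBall (0 : ℂ) r ∧ f z = 0) (h0 : f 0 = 0)
    (hd : ∀ z ∈ S, deriv f z ≠ 0) :
    circleAverage (fun z => log ‖f z‖) 0 r
      = ∑ u ∈ S, log (r * ‖u‖⁻¹) + log r + log ‖deriv f 0‖ := by
  have hmem : (0 : ℂ) ∈ Metric.closedBall (0 : ℂ) r := by simp [hr.le]
  have h0S : (0 : ℂ) ∈ S := (hS 0).2 ⟨hmem, h0⟩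
  have hdiv : ∀ z ∈ S, MeromorphicOn.divisor f (Metric.closedBall 0 r) z = 1 := by
    intro z hz
    obtain ⟨hzb, hz0⟩ := (hS z).1 hz
    rw [MeromorphicOn.AnalyticOnNhd.divisor_apply hf hzb,
      (hf z hzb).analyticOrderAt_eq_one_of_zero_deriv_ne_zero hz0 (hd z hz)]
    simp
  have hdiv' : ∀ z, z ∉ S → MeromorphicOn.divisor f (Metric.closedBall 0 r) z = 0 := by
    intro z hz
    by_cases hzb : z ∈ Metric.closedBall (0 : ℂ) r
    · rw [MeromorphicOn.AnalyticOnNhd.divisor_apply hf hzb]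
      have : f z ≠ 0 := fun h => hz ((hS z).2 ⟨hzb, h⟩)
      simp [analyticOrderAt_eq_zero.2 (Or.inr this)]
    · exact Function.locallyFinsuppWithin.apply_eq_zero_of_notMem _ hzb
  have hder := (hf 0 hmem).differentiableAt.hasDerivAt
  have hmero : MeromorphicAt f 0 := (hf 0 hmem).meromorphicAt
  have hord : meromorphicOrderAt f 0 = 1 := by
    rw [(hf 0 hmem).meromorphicOrderAt_eq,
      (hf 0 hmem).analyticOrderAt_eq_one_of_zero_deriv_ne_zero h0 (hd 0 h0S)]
    rfl
  have htr : meromorphicTrailingCoeffAt f 0 = deriv f 0 := by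
    refine tendsto_nhds_unique hmero.tendsto_nhds_meromorphicTrailingCoeffAt ?_
    have := hder.tendsto_slope
    refine this.congr fun z => ?_
    rw [hord]
    simp [slope_def_field, h0, div_eq_inv_mul]
  have hJ := MeromorphicOn.circleAverage_log_norm (c := 0) (R := r) (f := f) hr.ne'
    (by rw [abs_of_pos hr]; exact hf.meromorphicOn)
  rw [abs_of_pos hr] at hJ
  rw [hJ, htr, hdiv 0 h0S, finsum_eq_sum_of_support_subset (s := S)]
  · simp only [Int.cast_one, one_mul, zero_sub, norm_neg]
    congr 2
    exact Finset.sum_congr rfl fun z hz => by rw [hdiv z hz]; simp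
  · intro z hz
    by_contra h
    exact hz (by simp [hdiv' z h])

/-- The function `z ↦ sin (log (1 + z) / (2 α))`. -/
noncomputable def sinLogOneAdd (α : ℝ) (z : ℂ) : ℂ :=
  Complex.sin (Complex.log (1 + z) / (2 * α))

theorem one_add_re_pos {z : ℂ} (hz : ‖z‖ < 1) : 0 < (1 + z).re := by
  have := (abs_lt.1 ((Complex.abs_re_le_norm z).trans_lt hz)).1
  simp only [Complex.add_re, Complex.one_re]
  linarith

theorem hasDerivAt_sinLogOneAdd (α : ℝ) {z : ℂ} (hz : 0 < (1 + z).re) :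
    HasDerivAt (sinLogOneAdd α)
      (Complex.cos (Complex.log (1 + z) / (2 * α)) * ((1 + z)⁻¹ / (2 * α))) z := by
  have h1 : HasDerivAt (fun z : ℂ => 1 + z) 1 z := by
    simpa using (hasDerivAt_id z).const_add 1
  have h2 := ((h1.clog (Or.inl hz)).div_const (2 * (α : ℂ))).csin
  exact h2.congr_deriv (by simp)

theorem analyticAt_sinLogOneAdd (α : ℝ) {z : ℂ} (hz : 0 < (1 + z).re) :
    AnalyticAt ℂ (sinLogOneAdd α) z := by
  have h : (1 + z) ∈ Complex.slitPlane := Or.inl hz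
  refine AnalyticAt.comp (g := Complex.sin)
    (f := fun z => Complex.log (1 + z) / (2 * α)) (Complex.analyticAt_sin) ?_
  exact ((analyticAt_const.add analyticAt_id).clog h).div_const

theorem sinLogOneAdd_zero (α : ℝ) : sinLogOneAdd α 0 = 0 := by simp [sinLogOneAdd]

theorem deriv_sinLogOneAdd_zero (α : ℝ) : deriv (sinLogOneAdd α) 0 = (1 / (2 * α) : ℝ) := by
  rw [(hasDerivAt_sinLogOneAdd α (by simp)).deriv]
  simp

theorem deriv_sinLogOneAdd_ne_zero {α : ℝ} (hα : α ≠ 0) {z : ℂ} (hz : 0 < (1 + z).re)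
    (h : sinLogOneAdd α z = 0) : deriv (sinLogOneAdd α) z ≠ 0 := by
  rw [(hasDerivAt_sinLogOneAdd α hz).deriv]
  have h1 : (1 + z) ≠ 0 := fun h => by simp [h] at hz
  have h2 : Complex.cos (Complex.log (1 + z) / (2 * α)) ≠ 0 := by
    intro hc
    have := Complex.sin_sq_add_cos_sq (Complex.log (1 + z) / (2 * α))
    rw [hc] at this
    rw [sinLogOneAdd] at h
    simp [h] at this
  have h3 : (α : ℂ) ≠ 0 := by exact_mod_cast hα
  simp [h1, h2, h3]

theorem sinLogOneAdd_eq_zero_iff {α : ℝ} (hα : Real.log 2 / (2 * π) < α) {z : ℂ} (hz : ‖z‖ < 1) :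
    sinLogOneAdd α z = 0 ↔
      z = 0 ∨ ∃ n : ℕ, z = ((-(1 - Real.exp (-2 * π * α * (n + 1))) : ℝ) : ℂ) := by
  have hα0 : 0 < α := lt_of_le_of_lt (by positivity) hα
  have hαC : (α : ℂ) ≠ 0 := by exact_mod_cast hα0.ne'
  have hre := one_add_re_pos hz
  have h1 : (1 + z) ≠ 0 := fun h => by simp [h] at hre
  constructor
  · intro h
    rw [sinLogOneAdd, Complex.sin_eq_zero_iff] at h
    obtain ⟨k, hk⟩ := h
    have hlog : Complex.log (1 + z) = ((2 * π * α * k : ℝ) : ℂ) := by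
      rw [div_eq_iff (by simp [hαC])] at hk
      rw [hk]; push_cast; ring
    have hexp : z = ((Real.exp (2 * π * α * k) - 1 : ℝ) : ℂ) := by
      have := Complex.exp_log h1
      rw [hlog, ← Complex.ofReal_exp] at this
      push_cast at this ⊢
      rw [this]; ring
    have hnorm : |Real.exp (2 * π * α * k) - 1| < 1 := by
      rw [hexp, Complex.norm_real] at hz
      exact hz
    have hlt : Real.exp (2 * π * α * k) < 2 := by linarith [(abs_lt.1 hnorm).2]
    have hk1 : k < 1 := by
      by_contra hk1
      push Not at hk1
      have hk1' : (1 : ℝ) ≤ k := by exact_mod_cast hk1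
      have h2 : Real.log 2 < 2 * π * α := by
        rw [div_lt_iff₀ (by positivity)] at hα; linarith
      have h3 : 2 * π * α ≤ 2 * π * α * k := le_mul_of_one_le_right (by positivity) hk1'
      have h4 := Real.exp_lt_exp.2 (h2.trans_le h3)
      rw [Real.exp_log (by norm_num)] at h4
      linarith
    rcases (Int.lt_add_one_iff.1 (by simpa using hk1) : k ≤ 0).eq_or_lt with h0 | h0
    · left; rw [hexp, h0]; simp
    · right
      obtain ⟨n, hn⟩ := Int.eq_ofNat_of_zero_le (by omega : 0 ≤ -k - 1)
      refine ⟨n, ?_⟩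
      have hkn : (k : ℝ) = -((n : ℝ) + 1) := by
        have : k = -((n : ℤ) + 1) := by omega
        rw [this]; push_cast; ring
      rw [hexp, hkn]
      congr 1
      rw [show 2 * π * α * -((n : ℝ) + 1) = -2 * π * α * (n + 1) by ring]
      ring
  · rintro (rfl | ⟨n, rfl⟩)
    · exact sinLogOneAdd_zero α
    · rw [sinLogOneAdd, Complex.sin_eq_zero_iff]
      refine ⟨-((n : ℤ) + 1), ?_⟩
      have : (1 : ℂ) + ((-(1 - Real.exp (-2 * π * α * (n + 1))) : ℝ) : ℂ)
          = ((Real.exp (-2 * π * α * (n + 1)) : ℝ) : ℂ) := by push_cast; ring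
      rw [this, ← Complex.ofReal_log (Real.exp_pos _).le, Real.log_exp]
      push_cast
      field_simp

theorem circleAverage_log_norm_sinLogOneAdd {α : ℝ} (hα : Real.log 2 / (2 * π) < α)
    {b : ℕ → ℝ} (hb : ∀ n, b n = 1 - Real.exp (-2 * π * α * (n + 1))) (N : ℕ) :
    circleAverage (fun z => log ‖sinLogOneAdd α z‖) 0 (b N)
      = ((N : ℝ) + 2) * log (b N) - ∑ n ∈ Finset.range (N + 1), log (b n) - log (2 * α) := by
  have hα0 : 0 < α := lt_of_le_of_lt (by positivity) hα
  have hmono : StrictMono b := by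
    refine strictMono_nat_of_lt_succ fun n => ?_
    rw [hb, hb]
    have : Real.exp (-2 * π * α * ((n + 1 : ℕ) + 1)) < Real.exp (-2 * π * α * (n + 1)) := by
      apply Real.exp_lt_exp.2
      push_cast
      nlinarith [mul_pos Real.pi_pos hα0]
    linarith
  have hpos : ∀ n, 0 < b n := by
    intro n
    rw [hb, sub_pos, Real.exp_lt_one_iff]
    have : 0 < 2 * π * α * (n + 1) := by positivity
    linarith
  have hlt : ∀ n, b n < 1 := fun n => by
    rw [hb]; linarith [Real.exp_pos (-2 * π * α * (n + 1))]
  have hball : ∀ z ∈ Metric.closedBall (0 : ℂ) (b N), ‖z‖ < 1 := fun z hz =>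
    (mem_closedBall_zero_iff.1 hz).trans_lt (hlt N)
  set T : Finset ℂ := (Finset.range (N + 1)).image (fun n => ((-b n : ℝ) : ℂ)) with hT
  have hinj : Function.Injective (fun n => ((-b n : ℝ) : ℂ)) := by
    intro m n h
    exact hmono.injective (neg_injective (Complex.ofReal_injective h))
  have h0T : (0 : ℂ) ∉ T := by
    simp only [hT, Finset.mem_image, not_exists, not_and]
    intro n _ h
    have := (hpos n).ne'
    simp at h
    exact this h
  rw [circleAverage_log_norm_of_simple_zeros (hpos N)
    (fun z hz => analyticAt_sinLogOneAdd α (one_add_re_pos (hball z hz))) (insert 0 T) ?_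
    (sinLogOneAdd_zero α) ?_, Finset.sum_insert h0T, hT,
    Finset.sum_image (fun _ _ _ _ h => hinj h), deriv_sinLogOneAdd_zero]
  · have hterm : ∀ n, log (b N * ‖((-b n : ℝ) : ℂ)‖⁻¹) = log (b N) - log (b n) := by
      intro n
      rw [Complex.norm_real, norm_neg, Real.norm_of_nonneg (hpos n).le, ← div_eq_mul_inv,
        Real.log_div (hpos N).ne' (hpos n).ne']
    simp only [hterm]
    rw [Finset.sum_sub_distrib, Complex.norm_real, Real.norm_of_nonneg (by positivity), one_div,
      Real.log_inv]
    simp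
    ring
  · intro z
    constructor
    · intro hz
      rcases Finset.mem_insert.1 hz with rfl | hz
      · exact ⟨by simp [(hpos N).le], sinLogOneAdd_zero α⟩
      · obtain ⟨n, hn, rfl⟩ := Finset.mem_image.1 hz
        have hzb : ((-b n : ℝ) : ℂ) ∈ Metric.closedBall (0 : ℂ) (b N) := by
          rw [mem_closedBall_zero_iff, Complex.norm_real, norm_neg,
            Real.norm_of_nonneg (hpos n).le]
          exact hmono.monotone (Nat.lt_succ_iff.1 (Finset.mem_range.1 hn))
        exact ⟨hzb, (sinLogOneAdd_eq_zero_iff hα (hball _ hzb)).2 (Or.inr ⟨n, by rw [hb]⟩)⟩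
    · rintro ⟨hzb, hz⟩
      rcases (sinLogOneAdd_eq_zero_iff hα (hball _ hzb)).1 hz with rfl | ⟨n, rfl⟩
      · exact Finset.mem_insert_self _ _
      · rw [← hb] at hzb ⊢
        refine Finset.mem_insert_of_mem (Finset.mem_image.2 ⟨n, ?_, rfl⟩)
        rw [mem_closedBall_zero_iff, Complex.norm_real, norm_neg,
            Real.norm_of_nonneg (hpos n).le, hmono.le_iff_le] at hzb
        exact Finset.mem_range.2 (Nat.lt_succ_iff.2 hzb)
  · intro z hz
    have hz' : ‖z‖ < 1 ∧ sinLogOneAdd α z = 0 := by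
      rcases Finset.mem_insert.1 hz with rfl | hz
      · exact ⟨by simp, sinLogOneAdd_zero α⟩
      · obtain ⟨n, hn, rfl⟩ := Finset.mem_image.1 hz
        have hzb : ‖((-b n : ℝ) : ℂ)‖ < 1 := by
          rw [Complex.norm_real, norm_neg, Real.norm_of_nonneg (hpos n).le]
          exact hlt n
        exact ⟨hzb, (sinLogOneAdd_eq_zero_iff hα hzb).2 (Or.inr ⟨n, by rw [hb]⟩)⟩
    exact deriv_sinLogOneAdd_ne_zero hα0.ne' (one_add_re_pos hz'.1) hz'.2

theorem norm_sin_sq (z : ℂ) :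
    ‖Complex.sin z‖ ^ 2 = Real.sin z.re ^ 2 + Real.sinh z.im ^ 2 := by
  rw [← Complex.normSq_eq_norm_sq, Complex.sin_eq, Complex.normSq_apply]
  simp only [← Complex.ofReal_sin, ← Complex.ofReal_cos, ← Complex.ofReal_sinh,
    ← Complex.ofReal_cosh, ← Complex.ofReal_mul, Complex.add_re,
    Complex.add_im, Complex.re_ofReal_mul, Complex.im_ofReal_mul, Complex.ofReal_re,
    Complex.ofReal_im, Complex.I_re, Complex.I_im]
  linear_combination Real.sin z.re ^ 2 * Real.cosh_sq z.im +
    Real.sinh z.im ^ 2 * Real.sin_sq_add_cos_sq z.re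

theorem abs_im_le_norm_sin (z : ℂ) : |z.im| ≤ ‖Complex.sin z‖ := by
  have h1 : |z.im| ≤ |Real.sinh z.im| := by
    rw [Real.abs_sinh]
    exact Real.self_le_sinh_iff.2 (abs_nonneg _)
  refine h1.trans (abs_le_of_sq_le_sq' ?_ (norm_nonneg _) |> fun h => abs_le.2 h)
  rw [norm_sin_sq]
  nlinarith [sq_nonneg (Real.sin z.re)]

theorem norm_sin_le_cosh_im (z : ℂ) : ‖Complex.sin z‖ ≤ Real.cosh z.im := by
  refine le_of_sq_le_sq ?_ (Real.cosh_pos _).le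
  rw [norm_sin_sq, Real.cosh_sq]
  nlinarith [Real.sin_sq_le_one z.re]

theorem im_log_one_add_div (α : ℝ) (z : ℂ) :
    (Complex.log (1 + z) / (2 * α)).im = (1 + z).arg / (2 * α) := by
  rw [show (2 * α : ℂ) = ((2 * α : ℝ) : ℂ) by push_cast; ring, Complex.div_ofReal_im,
    Complex.log_im]

theorem norm_sinLogOneAdd_le {α : ℝ} (hα : 0 < α) (z : ℂ) :
    ‖sinLogOneAdd α z‖ ≤ Real.cosh (π / (2 * α)) := by
  refine (norm_sin_le_cosh_im _).trans (Real.cosh_le_cosh.2 ?_)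
  rw [im_log_one_add_div, abs_div, abs_div, abs_of_pos pi_pos]
  gcongr
  exact Complex.abs_arg_le_pi _

theorem le_norm_sinLogOneAdd {α : ℝ} (hα : 0 < α) {z : ℂ} (hz : ‖z‖ ≤ 1) :
    |z.im| / (4 * α) ≤ ‖sinLogOneAdd α z‖ := by
  refine le_trans ?_ (abs_im_le_norm_sin _)
  rw [im_log_one_add_div, abs_div, abs_of_pos (by positivity : 0 < 2 * α),
    div_le_div_iff₀ (by positivity) (by positivity)]
  have h1 : |z.im| ≤ 2 * |(1 + z).arg| := by
    by_cases h0 : 1 + z = 0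
    · have : z = -1 := by linear_combination h0
      simp [this]
    · have h2 : z.im = ‖1 + z‖ * Real.sin (1 + z).arg := by
        rw [Complex.sin_arg]
        have : ‖1 + z‖ ≠ 0 := norm_ne_zero_iff.2 h0
        field_simp
        simp
      have h3 : ‖1 + z‖ ≤ 2 := (norm_add_le _ _).trans (by simp; linarith)
      rw [h2, abs_mul, abs_norm]
      exact mul_le_mul h3 Real.abs_sin_le_abs (abs_nonneg _) (by norm_num)
  nlinarith

theorem measurable_sinLogOneAdd (α : ℝ) : Measurable (sinLogOneAdd α) := by
  unfold sinLogOneAdd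
  fun_prop

theorem abs_log_norm_sinLogOneAdd_circleMap_le {α : ℝ} (hα : 0 < α) {r : ℝ} (hr : 1 / 2 ≤ r)
    (hr1 : r ≤ 1) {θ : ℝ} (hθ : Real.sin θ ≠ 0) :
    |log ‖sinLogOneAdd α (circleMap 0 r θ)‖|
      ≤ log (Real.cosh (π / (2 * α))) + |log (8 * α)| + |log (Real.sin θ)| := by
  have hr0 : 0 < r := by linarith
  have hs : 0 < |Real.sin θ| := abs_pos.2 hθ
  have hC : 0 ≤ log (Real.cosh (π / (2 * α))) := Real.log_nonneg (Real.one_le_cosh _)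
  have hlow : |Real.sin θ| / (8 * α) ≤ ‖sinLogOneAdd α (circleMap 0 r θ)‖ := by
    refine le_trans ?_ (le_norm_sinLogOneAdd hα (by simpa [abs_of_pos hr0] using hr1))
    have him : (circleMap 0 r θ).im = r * Real.sin θ := by
      simp [circleMap, Complex.exp_ofReal_mul_I_im]
    rw [him, abs_mul, abs_of_pos hr0, div_le_div_iff₀ (by positivity) (by positivity)]
    nlinarith [mul_pos hs hα]
  have hpos : 0 < ‖sinLogOneAdd α (circleMap 0 r θ)‖ := lt_of_lt_of_le (by positivity) hlow
  have h1 := Real.log_le_log hpos (norm_sinLogOneAdd_le hα (circleMap 0 r θ))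
  have h2 := Real.log_le_log (by positivity) hlow
  rw [Real.log_div hs.ne' (by positivity), Real.log_abs] at h2
  rw [abs_le]
  constructor
  · linarith [neg_abs_le (log (Real.sin θ)), le_abs_self (log (8 * α))]
  · linarith [abs_nonneg (log (Real.sin θ)), abs_nonneg (log (8 * α))]

theorem intervalIntegrable_bound (c a b : ℝ) :
    IntervalIntegrable (fun θ => c + |log (Real.sin θ)|) volume a b :=
  intervalIntegrable_const.add (intervalIntegrable_log_sin (a := a) (b := b)).abs

theorem ae_sin_ne_zero : ∀ᵐ θ : ℝ, Real.sin θ ≠ 0 := by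
  have : {θ : ℝ | Real.sin θ = 0}.Countable := by
    have h : {θ : ℝ | Real.sin θ = 0} = Set.range (fun n : ℤ => (n : ℝ) * π) := by
      ext θ
      simp [Real.sin_eq_zero_iff]
    rw [h]
    exact Set.countable_range _
  exact measure_eq_zero_iff_ae_notMem.1 (this.measure_zero volume)

theorem aestronglyMeasurable_log_norm_sinLogOneAdd (α r : ℝ) (μ : Measure ℝ) :
    AEStronglyMeasurable (fun θ => log ‖sinLogOneAdd α (circleMap 0 r θ)‖) μ := by
  have h : Measurable (circleMap 0 r) := (continuous_circleMap 0 r).measurable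
  exact (((measurable_sinLogOneAdd α).comp h).norm.log).aestronglyMeasurable

theorem intervalIntegrable_log_norm_sinLogOneAdd {α : ℝ} (hα : 0 < α) (a b : ℝ) :
    IntervalIntegrable (fun θ => log ‖sinLogOneAdd α (circleMap 0 1 θ)‖) volume a b := by
  refine (intervalIntegrable_bound
    (log (Real.cosh (π / (2 * α))) + |log (8 * α)|) a b).mono_fun'
    (aestronglyMeasurable_log_norm_sinLogOneAdd α 1 _) ?_
  filter_upwards [ae_restrict_of_ae ae_sin_ne_zero] with θ hθ
  exact abs_log_norm_sinLogOneAdd_circleMap_le hα (by norm_num) le_rfl hθ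

theorem continuousAt_sinLogOneAdd (α : ℝ) {z : ℂ} (hz : z.im ≠ 0) :
    ContinuousAt (sinLogOneAdd α) z := by
  have h : (1 + z) ∈ Complex.slitPlane := Or.inr (by simpa using hz)
  unfold sinLogOneAdd
  have h1 : ContinuousAt (fun z : ℂ => Complex.log (1 + z)) z :=
    (continuousAt_const.add continuousAt_id).clog h
  exact Complex.continuous_sin.continuousAt.comp (h1.div_const _)

theorem tendsto_circleAverage_log_norm_sinLogOneAdd {α : ℝ} (hα : 0 < α) {b : ℕ → ℝ}
    (hb : Tendsto b atTop (𝓝 1)) (hb1 : ∀ n, b n ≤ 1) :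
    Tendsto (fun n => circleAverage (fun z => log ‖sinLogOneAdd α z‖) 0 (b n)) atTop
      (𝓝 (circleAverage (fun z => log ‖sinLogOneAdd α z‖) 0 1)) := by
  simp only [circleAverage_def]
  refine Tendsto.const_smul ?_ _
  refine intervalIntegral.tendsto_integral_filter_of_dominated_convergence
    (fun θ => log (Real.cosh (π / (2 * α))) + |log (8 * α)| + |log (Real.sin θ)|)
    (Eventually.of_forall fun n => aestronglyMeasurable_log_norm_sinLogOneAdd α _ _) ?_
    (intervalIntegrable_bound _ _ _) ?_
  · filter_upwards [hb.eventually (le_mem_nhds (by norm_num : (1 / 2 : ℝ) < 1))] with n hn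
    filter_upwards [ae_sin_ne_zero] with θ hθ _
    exact abs_log_norm_sinLogOneAdd_circleMap_le hα hn (hb1 n) hθ
  · filter_upwards [ae_sin_ne_zero] with θ hθ _
    have him : (circleMap 0 1 θ).im ≠ 0 := by
      simpa [circleMap, Complex.exp_ofReal_mul_I_im] using hθ
    have hne : ‖sinLogOneAdd α (circleMap 0 1 θ)‖ ≠ 0 := by
      refine (lt_of_lt_of_le ?_ (le_norm_sinLogOneAdd hα (by simp))).ne'
      have := abs_pos.2 him
      positivity
    have hlim : Tendsto (fun n => circleMap 0 (b n) θ) atTop (𝓝 (circleMap 0 1 θ)) := by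
      have hc : Continuous fun r : ℝ => circleMap 0 r θ := by unfold circleMap; fun_prop
      exact (hc.tendsto 1).comp hb
    exact (((continuousAt_sinLogOneAdd α him).tendsto.comp hlim).norm).log hne

theorem tendsto_natCast_add_two_mul_log_one_sub_exp {c : ℝ} (hc : 0 < c) :
    Tendsto (fun n : ℕ => ((n : ℝ) + 2) * log (1 - Real.exp (-c * (n + 1)))) atTop (𝓝 0) := by
  have hx : Tendsto (fun n : ℕ => (n : ℝ) + 1) atTop atTop :=
    tendsto_atTop_add_const_right _ _ tendsto_natCast_atTop_atTop
  have he : Tendsto (fun n : ℕ => Real.exp (-c * (n + 1))) atTop (𝓝 0) := by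
    refine Real.tendsto_exp_atBot.comp ?_
    exact hx.const_mul_atTop_of_neg (by linarith)
  have hxe : Tendsto (fun n : ℕ => ((n : ℝ) + 1) * Real.exp (-c * (n + 1))) atTop (𝓝 0) := by
    have h := (tendsto_rpow_mul_exp_neg_mul_atTop_nhds_zero 1 c hc).comp hx
    simpa [Function.comp_def] using h
  have hd : Tendsto (fun n : ℕ => 2 * (((n : ℝ) + 1) * Real.exp (-c * (n + 1))
      + Real.exp (-c * (n + 1)))) atTop (𝓝 0) := by
    simpa using (hxe.add he).const_mul 2
  refine squeeze_zero_norm' ?_ hd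
  filter_upwards [he.eventually (ge_mem_nhds (by norm_num : (0 : ℝ) < 1 / 2))] with n hn
  set q := Real.exp (-c * (n + 1)) with hq
  have hq0 : 0 < q := Real.exp_pos _
  have h1 : 0 < 1 - q := by linarith
  have hle : log (1 - q) ≤ 0 := Real.log_nonpos h1.le (by linarith)
  have hlow : -(2 * q) ≤ log (1 - q) := by
    have := Real.one_sub_inv_le_log_of_pos h1
    refine le_trans ?_ this
    have : (1 - q)⁻¹ ≤ 1 + 2 * q := by
      rw [inv_le_iff_one_le_mul₀ h1]
      nlinarith
    linarith
  rw [norm_mul, Real.norm_of_nonneg (by positivity), Real.norm_of_nonpos hle]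
  have : (0 : ℝ) ≤ n + 2 := by positivity
  nlinarith

theorem circleAverage_log_norm_sinLogOneAdd_one {α : ℝ} (hα : Real.log 2 / (2 * π) < α) :
    circleAverage (fun z => log ‖sinLogOneAdd α z‖) 0 1
      = -log (∏' n : ℕ, (1 - Real.exp (-2 * π * α * (n + 1)))) - log (2 * α) := by
  have hα0 : 0 < α := lt_of_le_of_lt (by positivity) hα
  have hc : 0 < 2 * π * α := by positivity
  have hx : Tendsto (fun n : ℕ => (n : ℝ) + 1) atTop atTop :=
    tendsto_atTop_add_const_right _ _ tendsto_natCast_atTop_atTop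
  have hpos : ∀ n : ℕ, 0 < 1 - Real.exp (-2 * π * α * (n + 1)) := by
    intro n
    rw [sub_pos, Real.exp_lt_one_iff]
    have : 0 < 2 * π * α * (n + 1) := by positivity
    linarith
  have hsum : Summable fun n : ℕ => Real.exp (-2 * π * α * (n + 1)) := by
    have h : Summable fun n : ℕ => Real.exp (n * (-(2 * π * α))) :=
      Real.summable_exp_nat_mul_iff.2 (by linarith)
    have h' := (summable_nat_add_iff 1).2 h
    refine h'.congr fun n => ?_
    congr 1
    push_cast
    ring
  have hlogsum : Summable fun n : ℕ => log (1 - Real.exp (-2 * π * α * (n + 1))) := by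
    simpa [sub_eq_add_neg] using Real.summable_log_one_add_of_summable hsum.neg
  have htp : log (∏' n : ℕ, (1 - Real.exp (-2 * π * α * (n + 1))))
      = ∑' n : ℕ, log (1 - Real.exp (-2 * π * α * (n + 1))) := by
    rw [← Real.rexp_tsum_eq_tprod hpos hlogsum, Real.log_exp]
  have hb : Tendsto (fun n : ℕ => 1 - Real.exp (-2 * π * α * (n + 1))) atTop (𝓝 1) := by
    simpa using hsum.tendsto_atTop_zero.const_sub 1
  refine tendsto_nhds_unique (tendsto_circleAverage_log_norm_sinLogOneAdd hα0 hb
    fun n => by linarith [Real.exp_pos (-2 * π * α * (n + 1))]) ?_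
  simp only [circleAverage_log_norm_sinLogOneAdd hα (fun n => rfl)]
  rw [htp]
  have h1 := tendsto_natCast_add_two_mul_log_one_sub_exp hc
  have h2 := (hlogsum.hasSum.tendsto_sum_nat).comp (tendsto_add_atTop_nat 1)
  have h3 := (h1.sub h2).sub_const (log (2 * α))
  rw [zero_sub] at h3
  refine h3.congr fun n => ?_
  simp only [Function.comp_apply]
  rw [show -(2 * π * α) = -2 * π * α by ring]

theorem norm_sinLogOneAdd_conj (α : ℝ) {z : ℂ} (hz : z.im ≠ 0) :
    ‖sinLogOneAdd α ((starRingEnd ℂ) z)‖ = ‖sinLogOneAdd α z‖ := by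
  have harg : (1 + z).arg ≠ π := by
    intro h
    have := (Complex.arg_eq_pi_iff.1 h).2
    exact hz (by simpa using this)
  have : sinLogOneAdd α ((starRingEnd ℂ) z) = (starRingEnd ℂ) (sinLogOneAdd α z) := by
    unfold sinLogOneAdd
    rw [show (2 * α : ℂ) = ((2 * α : ℝ) : ℂ) by push_cast; ring, ← Complex.sin_conj, map_div₀,
      Complex.conj_ofReal, ← Complex.log_conj _ harg]
    simp
  rw [this, Complex.norm_conj]

theorem integral_log_norm_sinLogOneAdd {α : ℝ} (hα : 0 < α) :
    ∫ θ in (0 : ℝ)..2 * π, log ‖sinLogOneAdd α (circleMap 0 1 θ)‖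
      = 4 * ∫ x in (0 : ℝ)..π / 2, log ‖sinLogOneAdd α (circleMap 0 1 (2 * x))‖ := by
  have hint := intervalIntegrable_log_norm_sinLogOneAdd hα
  have h1 : ∫ θ in π..2 * π, log ‖sinLogOneAdd α (circleMap 0 1 θ)‖
      = ∫ θ in (0 : ℝ)..π, log ‖sinLogOneAdd α (circleMap 0 1 θ)‖ := by
    have h := intervalIntegral.integral_comp_sub_left (a := 0) (b := π)
      (fun θ => log ‖sinLogOneAdd α (circleMap 0 1 θ)‖) (2 * π)
    rw [sub_zero, show 2 * π - π = π by ring] at h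
    rw [← h]
    refine intervalIntegral.integral_congr_ae ?_
    filter_upwards [ae_sin_ne_zero] with θ hθ _
    have him : (circleMap 0 1 θ).im ≠ 0 := by
      simpa [circleMap, Complex.exp_ofReal_mul_I_im] using hθ
    rw [← norm_sinLogOneAdd_conj α him, show 2 * π - θ = -θ + 2 * π by ring,
      periodic_circleMap, conj_circleMap_zero]
  rw [intervalIntegral.integral_comp_mul_left (fun θ => log ‖sinLogOneAdd α (circleMap 0 1 θ)‖)
    (by norm_num : (2 : ℝ) ≠ 0), mul_zero, show 2 * (π / 2) = π by ring,
    ← intervalIntegral.integral_add_adjacent_intervals (hint 0 π) (hint π (2 * π)), h1, smul_eq_mul]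
  ring

theorem cosh_sub_cos_eq {α x : ℝ} (hx : 0 < x) (hx' : x < π / 2) :
    Real.cosh (x / α) - Real.cos (Real.log (2 * Real.cos x) / α)
      = 2 * ‖sinLogOneAdd α (circleMap 0 1 (2 * x))‖ ^ 2 := by
  have hcos : 0 < Real.cos x := Real.cos_pos_of_mem_Ioo ⟨by linarith, hx'⟩
  have hone : 1 + circleMap 0 1 (2 * x)
      = ((2 * Real.cos x : ℝ) : ℂ) * Complex.exp (x * Complex.I) := by
    have h1 : Complex.exp (x * Complex.I) * Complex.exp (-(x * Complex.I)) = 1 := by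
      rw [← Complex.exp_add]; simp
    have h2 : Complex.exp (((2 * x : ℝ) : ℂ) * Complex.I)
        = Complex.exp (x * Complex.I) * Complex.exp (x * Complex.I) := by
      rw [← Complex.exp_add]; congr 1; push_cast; ring
    simp only [circleMap, zero_add, Complex.ofReal_one, one_mul, h2]
    rw [Complex.ofReal_mul, Complex.ofReal_cos, Complex.cos, neg_mul]
    push_cast
    linear_combination -h1
  have hlog : Complex.log (1 + circleMap 0 1 (2 * x))
      = ((Real.log (2 * Real.cos x) : ℝ) : ℂ) + x * Complex.I := by
    rw [hone, Complex.log_ofReal_mul (by positivity) (Complex.exp_ne_zero _), Complex.log_exp]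
    · simp; linarith [pi_pos]
    · simp; linarith [pi_pos]
  have hre : (Complex.log (1 + circleMap 0 1 (2 * x)) / (2 * α)).re
      = Real.log (2 * Real.cos x) / α / 2 := by
    rw [hlog, show (2 * α : ℂ) = ((2 * α : ℝ) : ℂ) by push_cast; ring, Complex.div_ofReal_re]
    simp only [Complex.add_re, Complex.ofReal_re, Complex.re_ofReal_mul, Complex.I_re]
    ring
  have him : (Complex.log (1 + circleMap 0 1 (2 * x)) / (2 * α)).im = x / α / 2 := by
    rw [hlog, show (2 * α : ℂ) = ((2 * α : ℝ) : ℂ) by push_cast; ring, Complex.div_ofReal_im]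
    simp only [Complex.add_im, Complex.ofReal_im, Complex.im_ofReal_mul, Complex.I_im]
    ring
  rw [sinLogOneAdd, norm_sin_sq, hre, him]
  have h1 := Real.cosh_two_mul (x / α / 2)
  have h2 := Real.cosh_sq (x / α / 2)
  have h3 := Real.cos_two_mul (Real.log (2 * Real.cos x) / α / 2)
  have h4 := Real.sin_sq_add_cos_sq (Real.log (2 * Real.cos x) / α / 2)
  rw [mul_div_cancel₀ _ (two_ne_zero)] at h1 h3
  linarith

theorem stmt_5 (α : ℝ) (hα : Real.log 2 / (2 * π) < α) :
    ∫ x in (0:ℝ)..(π/2), Real.log (Real.cosh (x/α) - Real.cos (Real.log (2 * Real.cos x) / α))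
      = -(π/2) * Real.log (2 * α^2)
        - π * Real.log (∏' n : ℕ, (1 - Real.exp (-2 * π * α * (n+1)))) := by
  have hα0 : 0 < α := lt_of_le_of_lt (by positivity) hα
  have hpi := pi_pos
  have hint : IntervalIntegrable
      (fun x => log ‖sinLogOneAdd α (circleMap 0 1 (2 * x))‖) volume 0 (π / 2) := by
    simpa using (intervalIntegrable_log_norm_sinLogOneAdd hα0 0 π).comp_mul_left (c := 2)
  have hcongr : ∫ x in (0:ℝ)..(π/2),
        Real.log (Real.cosh (x/α) - Real.cos (Real.log (2 * Real.cos x) / α))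
      = ∫ x in (0:ℝ)..(π/2),
        (log 2 + 2 * log ‖sinLogOneAdd α (circleMap 0 1 (2 * x))‖) := by
    refine intervalIntegral.integral_congr_ae ?_
    have hne : ∀ᵐ x : ℝ, x ≠ π / 2 := by simp [ae_iff]
    filter_upwards [hne] with x hx hmem
    rw [Set.uIoc_of_le (by positivity)] at hmem
    have hlt := lt_of_le_of_ne hmem.2 hx
    have hs : 0 < Real.sin (2 * x) :=
      Real.sin_pos_of_pos_of_lt_pi (by linarith [hmem.1]) (by linarith)
    have him : (circleMap 0 1 (2 * x)).im = Real.sin (2 * x) := by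
      have := Complex.exp_ofReal_mul_I_im (2 * x)
      simpa [circleMap] using this
    have hpos : 0 < ‖sinLogOneAdd α (circleMap 0 1 (2 * x))‖ := by
      refine lt_of_lt_of_le ?_ (le_norm_sinLogOneAdd hα0 (by simp))
      rw [him]
      have := abs_pos.2 hs.ne'
      positivity
    rw [cosh_sub_cos_eq hmem.1 hlt, Real.log_mul two_ne_zero (by positivity), Real.log_pow]
    norm_num
  have havg := circleAverage_log_norm_sinLogOneAdd_one hα
  rw [circleAverage_def, integral_log_norm_sinLogOneAdd hα0, smul_eq_mul] at havg
  rw [hcongr, intervalIntegral.integral_add intervalIntegrable_const (hint.const_mul 2),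
    intervalIntegral.integral_const, intervalIntegral.integral_const_mul, smul_eq_mul, sub_zero,
    Real.log_mul two_ne_zero (by positivity), Real.log_pow]
  rw [Real.log_mul two_ne_zero hα0.ne'] at havg
  generalize log (∏' n : ℕ, (1 - Real.exp (-2 * π * α * (n + 1)))) = P at havg ⊢
  field_simp at havg
  push_cast
  linear_combination havg / 2
end
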